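/- arXiv:2410.02636 — 6 statements merged into one kernel-verified Lean document; each statement's English description precedes it below -/
import Mathlib

section
/- Let F be a field, let U ⊆ F^n be a linear subspace containing a nonzero vector, and let t ≥ 1 be an integer. Define the t-fold tensor power U^{⊗t} ⊆ F^{({1,…,t}→{1,…,n})} as the set of functions f : ({1,…,t}→{1,…,n}) → F such that for every axis j ∈ {1,…,t} and every fixing of the coordinates other than j, the vector obtained by letting the j-th index range over {1,…,n} belongs to U. Then U^{⊗t} contains a nonzero element, and the minimum over nonzero f ∈ U^{⊗t} of the number of nonzero values of f equals d(U)^t. -/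
open Matrix

noncomputable section

/-- Hamming weight of a vector: number of nonzero coordinates. -/
def hw {F : Type*} [Zero F] {n : ℕ} (x : Fin n → F) : ℕ :=
  (Function.support x).ncard

/-- Minimum distance of a linear code. -/
def dmin {F : Type*} [Field F] {n : ℕ} (C : Submodule F (Fin n → F)) : ℕ :=
  sInf {w | ∃ u ∈ C, u ≠ 0 ∧ hw u = w}

/-- The `t`-fold tensor power of a code `U ⊆ F^n`: functions
`f : (Fin t → Fin n) → F` such that along every axis `j`, for every fixing of
the remaining coordinates, the resulting vector lies in `U`. -/
def tensorPow {F : Type*} [Field F] {n : ℕ} (U : Submodule F (Fin n → F)) (t : ℕ) :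
    Set ((Fin t → Fin n) → F) :=
  {f | ∀ (j : Fin t) (g : Fin t → Fin n),
      (fun a : Fin n => f (Function.update g j a)) ∈ U}

theorem exists_mem_hw_eq_dmin {F : Type*} [Field F] {n : ℕ} {U : Submodule F (Fin n → F)}
    (hU : ∃ u ∈ U, u ≠ 0) : ∃ u ∈ U, u ≠ 0 ∧ hw u = dmin U := by
  obtain ⟨u, hu, hu0⟩ := hU
  exact Nat.sInf_mem (s := {w | ∃ u ∈ U, u ≠ 0 ∧ hw u = w}) ⟨_, u, hu, hu0, rfl⟩

theorem dmin_le_hw {F : Type*} [Field F] {n : ℕ} {U : Submodule F (Fin n → F)}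
    {u : Fin n → F} (hu : u ∈ U) (hu0 : u ≠ 0) : dmin U ≤ hw u :=
  Nat.sInf_le ⟨u, hu, hu0, rfl⟩

theorem prod_mem_tensorPow {F : Type*} [Field F] {n : ℕ} {U : Submodule F (Fin n → F)}
    {u : Fin n → F} (hu : u ∈ U) (t : ℕ) :
    (fun g : Fin t → Fin n => ∏ i, u (g i)) ∈ tensorPow U t := by
  classical
  intro j g
  convert U.smul_mem (∏ i ∈ Finset.univ.erase j, u (g i)) hu using 1
  ext a
  beta_reduce
  rw [← Finset.prod_erase_mul _ _ (Finset.mem_univ j), Function.update_self]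
  simp only [Pi.smul_apply, smul_eq_mul]
  congr 1
  refine Finset.prod_congr rfl fun i hi => ?_
  rw [Function.update_of_ne (Finset.ne_of_mem_erase hi)]

theorem ncard_support_prod {F : Type*} [Field F] {n : ℕ} (u : Fin n → F) (t : ℕ) :
    (Function.support fun g : Fin t → Fin n => ∏ i, u (g i)).ncard = hw u ^ t := by
  classical
  have h : (Function.support fun g : Fin t → Fin n => ∏ i, u (g i)) =
      (Fintype.piFinset fun _ : Fin t => (Function.support u).toFinset : Finset _) := by
    ext g
    simp [Finset.prod_eq_zero_iff]
  rw [h, Set.ncard_coe_finset, Fintype.card_piFinset_const, hw, Set.ncard_eq_toFinset_card']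

theorem slice_mem_tensorPow {F : Type*} [Field F] {n t : ℕ} {U : Submodule F (Fin n → F)}
    {f : (Fin (t + 1) → Fin n) → F} (hf : f ∈ tensorPow U (t + 1)) (b : Fin n) :
    (fun g : Fin t → Fin n => f (Fin.cons b g)) ∈ tensorPow U t := by
  intro j g
  simpa only [Fin.cons_update] using hf j.succ (Fin.cons b g)

theorem dmin_pow_le_ncard_support {F : Type*} [Field F] {n : ℕ}
    (U : Submodule F (Fin n → F)) (t : ℕ) {f : (Fin t → Fin n) → F}
    (hf : f ∈ tensorPow U t) (hf0 : f ≠ 0) :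
    dmin U ^ t ≤ (Function.support f).ncard := by
  classical
  induction t with
  | zero =>
    rw [pow_zero, Nat.one_le_iff_ne_zero, ← Nat.pos_iff_ne_zero, Set.ncard_pos]
    exact Function.support_nonempty_iff.2 hf0
  | succ t ih =>
    obtain ⟨x, hx⟩ := Function.ne_iff.1 hf0
    have hcol : (fun b => f (Fin.cons b (Fin.tail x))) ∈ U := by
      have h := hf 0 (Fin.cons (x 0) (Fin.tail x))
      simpa only [Fin.update_cons_zero] using h
    have hcol0 : (fun b => f (Fin.cons b (Fin.tail x))) ≠ 0 :=
      Function.ne_iff.2 ⟨x 0, by simpa using hx⟩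
    have hd := dmin_le_hw hcol hcol0
    rw [hw, Set.ncard_eq_toFinset_card'] at hd
    set S := (Function.support fun b => f (Fin.cons b (Fin.tail x))).toFinset with hS
    let T : Fin n → Finset (Fin t → Fin n) := fun b =>
      (Function.support fun g : Fin t → Fin n => f (Fin.cons b g)).toFinset
    have hT : ∀ b ∈ S, dmin U ^ t ≤ (T b).card := by
      intro b hb
      rw [← Set.ncard_eq_toFinset_card']
      refine ih (slice_mem_tensorPow hf b) (Function.ne_iff.2 ⟨Fin.tail x, ?_⟩)
      simpa [hS] using hb
    calc dmin U ^ (t + 1) = dmin U * dmin U ^ t := pow_succ' _ _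
      _ ≤ S.card * dmin U ^ t := Nat.mul_le_mul_right _ hd
      _ ≤ ∑ b ∈ S, (T b).card := by simpa using Finset.card_nsmul_le_sum S _ _ hT
      _ = (S.sigma T).card := (Finset.card_sigma S T).symm
      _ ≤ (Function.support f).toFinset.card := by
        refine Finset.card_le_card_of_injOn
          (fun p => (Fin.cons p.1 p.2 : Fin (t + 1) → Fin n)) ?_ ?_
        · rintro ⟨b, g⟩ h
          have hg := (Finset.mem_sigma.1 h).2
          simpa [T] using hg
        · rintro ⟨b, g⟩ - ⟨c, k⟩ - h
          obtain ⟨rfl, rfl⟩ := Fin.cons_inj.1 h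
          rfl
      _ = (Function.support f).ncard := (Set.ncard_eq_toFinset_card' _).symm

theorem stmt1 {F : Type*} [Field F] {n : ℕ} (U : Submodule F (Fin n → F))
    (hU : ∃ u ∈ U, u ≠ 0) (t : ℕ) (ht : 1 ≤ t) :
    (∃ f ∈ tensorPow U t, f ≠ 0) ∧
    sInf {w | ∃ f ∈ tensorPow U t, f ≠ 0 ∧ (Function.support f).ncard = w} =
      dmin U ^ t := by
  obtain ⟨u, hu, hu0, hw_eq⟩ := exists_mem_hw_eq_dmin hU
  have hmem := prod_mem_tensorPow hu t
  have hne : (fun g : Fin t → Fin n => ∏ i, u (g i)) ≠ 0 := by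
    obtain ⟨a, ha⟩ := Function.ne_iff.1 hu0
    exact Function.ne_iff.2 ⟨fun _ => a, Finset.prod_ne_zero_iff.2 fun _ _ => ha⟩
  refine ⟨⟨_, hmem, hne⟩, le_antisymm ?_ ?_⟩
  · exact Nat.sInf_le ⟨_, hmem, hne, by rw [ncard_support_prod, hw_eq]⟩
  · refine le_csInf ⟨_, _, hmem, hne, rfl⟩ ?_
    rintro _ ⟨f, hf, hf0, rfl⟩
    exact dmin_pow_le_ncard_support U t hf hf0
end
end

section
/- Let F be a finite field with q elements and let u, v ∈ F^n. Then there exists a nonzero λ ∈ F such that (q−1)·‖u − λ·v‖₀ ≤ (q−1)·|supp(u) ∪ supp(v)| − |supp(u) ∩ supp(v)|. -/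
noncomputable section

/-- Some nonzero scalar occurs as a ratio `u i / v i` on at least a `1 / (q - 1)` fraction of the
common support of `u` and `v`. -/
theorem exists_ne_zero_card_inter_support_le {F ι : Type*} [Field F] [Fintype F] [DecidableEq F]
    [Fintype ι] (u v : ι → F) :
    ∃ c : F, c ≠ 0 ∧
      (Finset.univ.filter fun i => u i ≠ 0 ∧ v i ≠ 0).card ≤
        (Fintype.card F - 1) *
          (Finset.univ.filter fun i => (u i ≠ 0 ∧ v i ≠ 0) ∧ u i / v i = c).card := by
  have hsum := Finset.card_eq_sum_card_fiberwise
    (s := Finset.univ.filter fun i => u i ≠ 0 ∧ v i ≠ 0)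
    (t := Finset.univ.erase (0 : F)) (f := fun i => u i / v i)
    (by intro i hi; simpa using hi)
  obtain ⟨c, hc, hmax⟩ := Finset.exists_max_image (Finset.univ.erase (0 : F))
    (fun c => (Finset.univ.filter fun i => (u i ≠ 0 ∧ v i ≠ 0) ∧ u i / v i = c).card)
    ⟨1, by simp⟩
  refine ⟨c, (Finset.mem_erase.mp hc).1, ?_⟩
  rw [hsum]
  simp only [Finset.filter_filter]
  refine (Finset.sum_le_card_nsmul _ _ _ hmax).trans ?_
  rw [Finset.card_erase_of_mem (Finset.mem_univ _), Finset.card_univ, smul_eq_mul]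

theorem stmt5 {F : Type*} [Field F] [Fintype F] {q n : ℕ}
    (hq : Fintype.card F = q) (u v : Fin n → F) :
    ∃ lam : F, lam ≠ 0 ∧
      ((q : ℤ) - 1) * (hw (u - lam • v) : ℤ) ≤
        ((q : ℤ) - 1) * ((Function.support u ∪ Function.support v).ncard : ℤ) -
          ((Function.support u ∩ Function.support v).ncard : ℤ) := by
  classical
  obtain ⟨c, hc, hle⟩ := exists_ne_zero_card_inter_support_le u v
  refine ⟨c, hc, ?_⟩
  set Z := Finset.univ.filter fun i => (u i ≠ 0 ∧ v i ≠ 0) ∧ u i / v i = c with hZ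
  have hinter : (Function.support u ∩ Function.support v).ncard =
      (Finset.univ.filter fun i => u i ≠ 0 ∧ v i ≠ 0).card := by
    rw [← Set.ncard_coe_finset]
    congr 1
    ext i
    simp
  have hunion : hw (u - c • v) + Z.card ≤
      (Function.support u ∪ Function.support v).ncard := by
    rw [hw, ← Set.ncard_coe_finset, ← Set.ncard_union_eq _ (Set.toFinite _) (Set.toFinite _)]
    · refine Set.ncard_le_ncard (Set.union_subset ?_ ?_) (Set.toFinite _)
      · intro i hi
        by_contra h
        simp_all
      · intro i hi
        simp only [hZ, Finset.coe_filter, Set.mem_ofPred_eq] at hi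
        exact Or.inl hi.2.1.1
    · rw [Set.disjoint_left]
      intro i hi hiZ
      simp only [hZ, Finset.coe_filter, Set.mem_ofPred_eq] at hiZ
      apply hi
      simp [(div_eq_iff hiZ.2.1.2).mp hiZ.2.2]
  have hq1 : 1 ≤ q := hq ▸ Fintype.card_pos
  rw [hq] at hle
  rw [hinter]
  zify [hq1] at hle hunion
  have hq0 : (0 : ℤ) ≤ (q : ℤ) - 1 := by omega
  linarith [mul_le_mul_of_nonneg_left hunion hq0]
end
end

section
/- For every real ε ∈ (0,1), every finite field F with q elements, and every integer n ≥ 1, there exist an integer N with 1 ≤ N ≤ (qn/ε)² and an injective F-linear map G : F^n → F^N such that every nonzero x ∈ F^n satisfies (1−ε)·(1−1/q)·N ≤ ‖G(x)‖₀ ≤ (1−1/q)·N (inequalities of real numbers). In particular, G is the encoding map of a linear code whose minimum distance is at least (1−ε)(1−1/q)N. -/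
noncomputable section

open Classical in
/-- A nonzero linear functional on a finite space is nonzero on a `1 - 1/q` fraction of vectors. -/
theorem card_filter_functional_ne_zero {F V : Type*} [Field F] [Fintype F] [AddCommGroup V]
    [Module F V] [Fintype V] (f : V →ₗ[F] F) (hf : f ≠ 0) :
    ((Finset.univ.filter fun v => f v ≠ 0).card : ℝ) =
      (1 - 1 / (Fintype.card F : ℝ)) * Fintype.card V := by
  have hq : (Fintype.card F : ℝ) ≠ 0 := by exact_mod_cast Fintype.card_ne_zero
  have hker : Nat.card V = Nat.card (LinearMap.ker f) * Nat.card F := by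
    rw [Submodule.card_eq_card_quotient_mul_card (LinearMap.ker f),
      Nat.card_congr (f.quotKerEquivOfSurjective (LinearMap.surjective hf)).toEquiv]
  have hzero : Nat.card (LinearMap.ker f) = (Finset.univ.filter fun v => f v = 0).card := by
    rw [← Fintype.card_subtype, ← Nat.card_eq_fintype_card]
    exact Nat.card_congr (Equiv.subtypeEquivRight fun v => LinearMap.mem_ker)
  have hsplit := Finset.card_filter_add_card_filter_not (s := (Finset.univ : Finset V))
    (fun v => f v = 0)
  rw [hzero, Nat.card_eq_fintype_card, Nat.card_eq_fintype_card] at hker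
  rw [Finset.card_univ] at hsplit
  have h₁ : (Fintype.card V : ℝ) = (Finset.univ.filter fun v => f v = 0).card * Fintype.card F := by
    exact_mod_cast hker
  have h₂ : ((Finset.univ.filter fun v => f v = 0).card : ℝ) +
      (Finset.univ.filter fun v => f v ≠ 0).card = Fintype.card V := by
    exact_mod_cast hsplit
  have h₃ : 1 / (Fintype.card F : ℝ) * Fintype.card V =
      (Finset.univ.filter fun v => f v = 0).card := by
    rw [h₁]; field_simp
  linarith

open Classical in
/-- For a vector-valued function `g`, the functions `(a, φ) ↦ φ (g a)` concatenating `g` with the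
Hadamard code have weight equal to the weight of `g` times that of the Hadamard code. -/
theorem card_filter_dual_apply_ne_zero {F V A : Type*} [Field F] [Fintype F] [AddCommGroup V]
    [Module F V] [Fintype A] [Fintype (Module.Dual F V)] (g : A → V) :
    ((Finset.univ.filter fun z : A × Module.Dual F V => z.2 (g z.1) ≠ 0).card : ℝ) =
      (Finset.univ.filter fun a => g a ≠ 0).card *
        ((1 - 1 / (Fintype.card F : ℝ)) * Fintype.card (Module.Dual F V)) := by
  have hfib (a : A) : ((Finset.univ.filter fun φ : Module.Dual F V => φ (g a) ≠ 0).card : ℝ) =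
      if g a ≠ 0 then (1 - 1 / (Fintype.card F : ℝ)) * Fintype.card (Module.Dual F V) else 0 := by
    split_ifs with h
    · refine card_filter_functional_ne_zero (Module.Dual.eval F V (g a)) fun h0 => h ?_
      exact (Module.forall_dual_apply_eq_zero_iff F _).1 fun φ => LinearMap.congr_fun h0 φ
    · simp [not_not.1 h]
  have hsum : (Finset.univ.filter fun z : A × Module.Dual F V => z.2 (g z.1) ≠ 0).card =
      ∑ a, (Finset.univ.filter fun φ : Module.Dual F V => φ (g a) ≠ 0).card := by
    simp only [Finset.card_filter, Fintype.sum_prod_type]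
  rw [hsum, Nat.cast_sum, Finset.sum_congr rfl fun a _ => hfib a, ← Finset.sum_filter,
    Finset.sum_const, nsmul_eq_mul]

open Classical Polynomial in
/-- A nonzero polynomial of degree less than `n` is nonzero at all but at most `n` points. -/
theorem card_le_card_filter_aeval_ne_zero_add {F K : Type*} [Field F] [Field K] [Algebra F K]
    [Fintype K] {n : ℕ} {p : F[X]} (hp : p ≠ 0) (hdeg : p.degree < n) :
    Fintype.card K ≤ (Finset.univ.filter fun a : K => aeval a p ≠ 0).card + n := by
  have hroots : (Finset.univ.filter fun a : K => aeval a p = 0).card ≤ n := by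
    calc _ ≤ (p.aroots K).toFinset.card := by
          refine Finset.card_le_card fun a ha => ?_
          simpa [mem_aroots, hp] using ha
      _ ≤ (p.aroots K).card := Multiset.toFinset_card_le _
      _ ≤ (p.map (algebraMap F K)).natDegree := card_roots' _
      _ ≤ n := by
          rw [natDegree_map]
          exact ((natDegree_lt_iff_degree_lt hp).2 hdeg).le
  have hsplit := Finset.card_filter_add_card_filter_not (s := (Finset.univ : Finset K))
    (fun a => aeval a p = 0)
  rw [Finset.card_univ] at hsplit
  simp only [ne_eq]
  omega

open Classical in
/-- The Hamming weight of a function transported along an enumeration of its index type. -/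
theorem hw_comp_equiv {F ι : Type*} [Zero F] [Fintype ι] {N : ℕ} (e : Fin N ≃ ι) (f : ι → F) :
    hw (fun i => f (e i)) = (Finset.univ.filter fun z => f z ≠ 0).card := by
  have himage : Function.support f = e '' Function.support (fun i => f (e i)) := by
    ext z
    exact ⟨fun h => ⟨e.symm z, by simpa using h, by simp⟩, by rintro ⟨i, hi, rfl⟩; exact hi⟩
  rw [hw, ← Set.ncard_image_of_injective _ e.injective, ← himage, ← Set.ncard_coe_finset]
  congr 1
  ext z
  simp

/-- The Reed–Solomon code over an extension `K` of `F`, restricted to polynomials over `F` and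
concatenated with the Hadamard code. -/
def rsHadamard (F K : Type*) [Field F] [Field K] [Algebra F K] (n : ℕ) {N : ℕ}
    (e : Fin N → K × Module.Dual F K) : (Fin n → F) →ₗ[F] (Fin N → F) :=
  LinearMap.pi fun i => (e i).2 ∘ₗ (Polynomial.aeval (e i).1).toLinearMap ∘ₗ
    (Polynomial.degreeLT F n).subtype ∘ₗ (Polynomial.degreeLTEquiv F n).symm.toLinearMap

/-- Weights of the concatenated Reed–Solomon–Hadamard code. -/
theorem hw_rsHadamard_bounds {F K : Type*} [Field F] [Fintype F] [Field K] [Algebra F K]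
    [Fintype K] [Fintype (Module.Dual F K)] {n N : ℕ} (e : Fin N ≃ K × Module.Dual F K)
    {x : Fin n → F} (hx : x ≠ 0) :
    ((Fintype.card K : ℝ) - n) *
        ((1 - 1 / (Fintype.card F : ℝ)) * Fintype.card (Module.Dual F K)) ≤
      hw (rsHadamard F K n e x) ∧
    (hw (rsHadamard F K n e x) : ℝ) ≤ (Fintype.card K : ℝ) *
        ((1 - 1 / (Fintype.card F : ℝ)) * Fintype.card (Module.Dual F K)) := by
  classical
  set p := (Polynomial.degreeLTEquiv F n).symm x with hp
  have hp0 : (p : Polynomial F) ≠ 0 := by simpa [hp] using hx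
  have hdeg : (p : Polynomial F).degree < n := Polynomial.mem_degreeLT.1 p.2
  have hw_eq : (hw (rsHadamard F K n e x) : ℝ) = _ :=
    (congrArg Nat.cast (hw_comp_equiv e fun z => z.2 (Polynomial.aeval z.1 (p : Polynomial F)))).trans
      (card_filter_dual_apply_ne_zero (F := F) fun a : K => Polynomial.aeval a (p : Polynomial F))
  have hq : (1 : ℝ) / Fintype.card F ≤ 1 :=
    div_le_one_of_le₀ (by exact_mod_cast Fintype.card_pos) (by positivity)
  have hnonneg : 0 ≤ (1 - 1 / (Fintype.card F : ℝ)) * Fintype.card (Module.Dual F K) :=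
    mul_nonneg (by linarith) (by positivity)
  rw [hw_eq]
  constructor
  · refine mul_le_mul_of_nonneg_right ?_ hnonneg
    rw [sub_le_iff_le_add]
    exact_mod_cast card_le_card_filter_aeval_ne_zero_add (K := K) hp0 hdeg
  · refine mul_le_mul_of_nonneg_right ?_ hnonneg
    exact_mod_cast Finset.card_le_univ _

theorem stmt6 (ε : ℝ) (hε : ε ∈ Set.Ioo (0 : ℝ) 1)
    (F : Type*) [Field F] [Fintype F] (q : ℕ) (hq : Fintype.card F = q)
    (n : ℕ) (hn : 1 ≤ n) :
    ∃ N : ℕ, 1 ≤ N ∧ (N : ℝ) ≤ ((q : ℝ) * n / ε) ^ 2 ∧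
      ∃ G : (Fin n → F) →ₗ[F] (Fin N → F), Function.Injective G ∧
        ∀ x : Fin n → F, x ≠ 0 →
          (1 - ε) * (1 - 1 / (q : ℝ)) * N ≤ (hw (G x) : ℝ) ∧
          (hw (G x) : ℝ) ≤ (1 - 1 / (q : ℝ)) * N := by
  obtain ⟨hε0, hε1⟩ := hε
  have hq1 : (1 : ℝ) < q := by
    rw [← hq]; exact_mod_cast Fintype.one_lt_card
  have hn1 : (1 : ℝ) ≤ n := by exact_mod_cast hn
  obtain ⟨k, hk₁, hk₂⟩ := exists_nat_pow_near (x := (n : ℝ) / ε) (y := q)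
    ((one_le_div hε0).2 (by linarith)) hq1
  obtain ⟨p, hchar⟩ := CharP.exists F
  have : Fact p.Prime := ⟨CharP.char_is_prime F p⟩
  let K := FiniteField.Extension F p (k + 1)
  have : Fintype K := Fintype.ofFinite K
  have : Finite (Module.Dual F K) := Module.finite_of_finite F
  have : Fintype (Module.Dual F K) := Fintype.ofFinite _
  have hcard : Fintype.card K = q ^ (k + 1) := by
    rw [← Nat.card_eq_fintype_card, FiniteField.natCard_extension, Nat.card_eq_fintype_card, hq]
  have hcard_dual : Fintype.card (Module.Dual F K) = q ^ (k + 1) := by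
    rw [Module.card_eq_pow_finrank (K := F), Subspace.dual_finrank_eq,
      FiniteField.finrank_extension, hq]
  set Q : ℕ := q ^ (k + 1) with hQ
  have hQ_lower : (n : ℝ) < ε * Q := by
    rw [div_lt_iff₀ hε0] at hk₂
    rw [hQ]; push_cast; linarith
  have hQ_upper : (Q : ℝ) ≤ q * n / ε := by
    rw [hQ, mul_div_assoc, pow_succ']; push_cast
    exact mul_le_mul_of_nonneg_left hk₁ (by linarith)
  have hQ_pos : (0 : ℝ) < Q := by
    rw [hQ]; push_cast; positivity
  have hN : Fintype.card (K × Module.Dual F K) = Q * Q := by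
    rw [Fintype.card_prod, hcard, hcard_dual]
  let e : Fin (Q * Q) ≃ K × Module.Dual F K := (Fintype.equivFinOfCardEq hN).symm
  have hq_frac : (0 : ℝ) < 1 - 1 / (q : ℝ) := sub_pos.2 ((div_lt_one (by linarith)).2 hq1)
  have hbounds (x : Fin n → F) (hx : x ≠ 0) :
      (1 - ε) * (1 - 1 / (q : ℝ)) * (Q * Q : ℕ) ≤ (hw (rsHadamard F K n e x) : ℝ) ∧
      (hw (rsHadamard F K n e x) : ℝ) ≤ (1 - 1 / (q : ℝ)) * (Q * Q : ℕ) := by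
    obtain ⟨hl, hu⟩ := hw_rsHadamard_bounds e hx
    rw [hcard, hcard_dual, hq] at hl hu
    push_cast
    constructor
    · refine le_trans ?_ hl
      have := mul_le_mul_of_nonneg_right (show (1 - ε) * Q ≤ Q - n by linarith)
        (mul_pos hq_frac hQ_pos).le
      linarith
    · linarith
  refine ⟨Q * Q, ?_, ?_, rsHadamard F K n e, ?_, hbounds⟩
  · have : 0 < Q := by exact_mod_cast hQ_pos
    exact Nat.mul_pos this this
  · rw [sq]; push_cast
    exact mul_self_le_mul_self hQ_pos.le hQ_upper
  · rw [injective_iff_map_eq_zero]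
    intro x hx
    by_contra hne
    have hl := (hbounds x hne).1
    rw [hx] at hl
    have hpos : 0 < (1 - ε) * (1 - 1 / (q : ℝ)) * (Q * Q : ℕ) := by
      push_cast
      exact mul_pos (mul_pos (by linarith) hq_frac) (mul_pos hQ_pos hQ_pos)
    have hzero : hw (0 : Fin (Q * Q) → F) = 0 := by simp [hw]
    rw [hzero, Nat.cast_zero] at hl
    exact absurd hl hpos.not_ge
end
end

section
/- Let F be a finite field with q elements, let G be an N×n matrix over F, let d ≥ 1 be an integer and ε ≥ 0 a real number such that every nonzero y ∈ F^n satisfies d ≤ ‖Gy‖₀ ≤ (1+ε)·d. Let Q_1, …, Q_m be n×n matrices over F, and suppose x ∈ F^n is a nonzero vector all of whose entries are 0 or 1 and which satisfies Q_ℓ(xxᵀ) = 0 for every ℓ ∈ {1,…,m}. Then the matrix Y := (Gx)(Gx)ᵀ = G(xxᵀ)Gᵀ is nonzero, xxᵀ is symmetric and satisfies Q_ℓ(xxᵀ) = 0 for all ℓ, and ‖Y‖₀ ≤ (1+ε)²·d² (as real numbers). -/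
open Matrix

noncomputable section

/-- Hamming weight of a matrix: number of nonzero entries. -/
def hwM {F : Type*} [Zero F] {n m : ℕ} (M : Matrix (Fin n) (Fin m) F) : ℕ :=
  (Function.support fun p : Fin n × Fin m => M p.1 p.2).ncard

/-- Evaluation of the homogeneous quadratic form with coefficient matrix `Q`
on a matrix `X`: `Q(X) = ∑ i j, Q[i,j]·X[i,j]`. -/
def Qapp {F : Type*} [Field F] {n : ℕ} (Q X : Matrix (Fin n) (Fin n) F) : F :=
  ∑ i, ∑ j, Q i j * X i j

/-- The Hamming weight of an outer product is the product of the Hamming weights. -/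
theorem hwM_vecMulVec {F : Type*} [Field F] {n m : ℕ} (u : Fin n → F) (v : Fin m → F) :
    hwM (vecMulVec u v) = hw u * hw v := by
  have h : (Function.support fun p : Fin n × Fin m => vecMulVec u v p.1 p.2) =
      Function.support u ×ˢ Function.support v := by
    ext p
    simp [vecMulVec_apply]
  rw [hwM, h, Set.ncard_prod, hw, hw]

theorem hw_zero {F : Type*} [Zero F] {n : ℕ} : hw (0 : Fin n → F) = 0 := by
  simp [hw]

theorem stmt8 {F : Type*} [Field F] [Fintype F] {q N n m : ℕ}
    (hq : Fintype.card F = q)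
    (G : Matrix (Fin N) (Fin n) F) (d : ℕ) (hd : 1 ≤ d) (ε : ℝ) (hε : 0 ≤ ε)
    (hG : ∀ y : Fin n → F, y ≠ 0 →
      (d : ℝ) ≤ (hw (G.mulVec y) : ℝ) ∧ (hw (G.mulVec y) : ℝ) ≤ (1 + ε) * d)
    (Q : Fin m → Matrix (Fin n) (Fin n) F)
    (x : Fin n → F) (hx : x ≠ 0) (hx01 : ∀ i, x i = 0 ∨ x i = 1)
    (hQ : ∀ ℓ, Qapp (Q ℓ) (vecMulVec x x) = 0) :
    vecMulVec (G.mulVec x) (G.mulVec x) ≠ 0 ∧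
    vecMulVec (G.mulVec x) (G.mulVec x) = G * vecMulVec x x * Gᵀ ∧
    (vecMulVec x x)ᵀ = vecMulVec x x ∧
    (∀ ℓ, Qapp (Q ℓ) (vecMulVec x x) = 0) ∧
    (hwM (vecMulVec (G.mulVec x) (G.mulVec x)) : ℝ) ≤ (1 + ε) ^ 2 * d ^ 2 := by
  obtain ⟨hlow, hup⟩ := hG x hx
  refine ⟨?_, ?_, transpose_vecMulVec x x, hQ, ?_⟩
  · have hGx : G.mulVec x ≠ 0 := by
      intro h
      rw [h, hw_zero] at hlow
      have : d ≤ 0 := by exact_mod_cast hlow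
      omega
    exact vecMulVec_ne_zero hGx hGx
  · rw [mul_vecMulVec, vecMulVec_mul, vecMul_transpose]
  · rw [hwM_vecMulVec, Nat.cast_mul, ← mul_pow, sq]
    exact mul_self_le_mul_self (Nat.cast_nonneg _) hup
end
end

section
/- Let F be a finite field with q elements, let G be an N×n matrix over F such that Gx = 0 implies x = 0, and let d ≥ 1 be an integer such that every nonzero y ∈ F^n satisfies ‖Gy‖₀ ≥ d. Let Q_1, …, Q_m be n×n matrices over F, and suppose that no nonzero a ∈ F^n satisfies Q_ℓ(aaᵀ) = 0 for all ℓ ∈ {1,…,m}. Then for every symmetric matrix X ∈ F^{n×n} with X ≠ 0 and Q_ℓ(X) = 0 for all ℓ, the matrix Y := GXGᵀ is nonzero and satisfies q·‖Y‖₀ ≥ (q+1)·d². -/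
open Matrix

noncomputable section

theorem hw_eq_sum {F : Type*} [Zero F] [DecidableEq F] {n : ℕ} (x : Fin n → F) :
    hw x = ∑ i, if x i ≠ 0 then 1 else 0 := by
  rw [hw, Finset.sum_boole, Nat.cast_id, ← Set.ncard_coe_finset, Finset.coe_filter_univ]
  rfl

theorem hwM_eq_sum_hw {F : Type*} [Zero F] {n m : ℕ} (M : Matrix (Fin n) (Fin m) F) :
    hwM M = ∑ i, hw (M i) := by
  classical
  simp only [hw_eq_sum]
  rw [hwM, ← Fintype.sum_prod_type', Finset.sum_boole, Nat.cast_id, ← Set.ncard_coe_finset,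
    Finset.coe_filter_univ]
  rfl

/-- For each pair `(x, y) ≠ 0`, at most `q` of the `q + 1` values `x` and `y + c x` are nonzero. -/
theorem sum_nonzero_combinations_le {F : Type*} [Field F] [Fintype F] [DecidableEq F] (x y : F) :
    (if x ≠ 0 then 1 else 0) + ∑ c : F, (if y + c * x ≠ 0 then 1 else 0) ≤
      Fintype.card F * if x ≠ 0 ∨ y ≠ 0 then 1 else 0 := by
  by_cases hx : x = 0
  · by_cases hy : y = 0 <;> simp [hx, hy]
  · have hlt : (Finset.univ.filter fun c : F => y + c * x ≠ 0).card < Fintype.card F := by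
      refine Finset.card_lt_univ_of_notMem (x := -y / x) ?_
      simp [hx]
    simp only [Finset.sum_boole, Nat.cast_id, ne_eq, hx, not_false_eq_true, true_or, if_true]
      at hlt ⊢
    omega

/-- The support of a two-dimensional space of vectors, all of whose nonzero elements have weight
at least `d`, has size at least `(q + 1) d / q`. -/
theorem succ_card_mul_le_card_mul_support {F : Type*} [Field F] [Fintype F] [DecidableEq F]
    {N : ℕ} (u v : Fin N → F) (d : ℕ) (hu : d ≤ hw u) (hv : ∀ c : F, d ≤ hw (v + c • u)) :
    (Fintype.card F + 1) * d ≤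
      Fintype.card F * ∑ i, if u i ≠ 0 ∨ v i ≠ 0 then 1 else 0 := by
  calc (Fintype.card F + 1) * d = d + ∑ _c : F, d := by
        simp [add_mul, add_comm]
    _ ≤ hw u + ∑ c : F, hw (v + c • u) := by gcongr with c; exact hv c
    _ = ∑ i, ((if u i ≠ 0 then 1 else 0) + ∑ c : F, if v i + c * u i ≠ 0 then 1 else 0) := by
        simp only [hw_eq_sum, Finset.sum_add_distrib]
        rw [Finset.sum_comm]
        rfl
    _ ≤ _ := by
        rw [Finset.mul_sum]
        gcongr with i
        exact sum_nonzero_combinations_le (u i) (v i)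

/-- A nonzero symmetric matrix all of whose columns are multiples of a single one is
a nonzero multiple of some `a aᵀ`. -/
theorem exists_eq_smul_vecMulVec_self {F ι : Type*} [Field F] {X : Matrix ι ι F}
    (hX : Xᵀ = X) {i j : ι} (hij : X i j ≠ 0) (h : ∀ l, ∃ c : F, X.col l = c • X.col j) :
    ∃ c : F, c ≠ 0 ∧ X = c • vecMulVec (X.col j) (X.col j) := by
  choose b hb using h
  have hentry (k l : ι) : X k l = b l * X k j := congrFun (hb l) k
  have hsymm (k l : ι) : X k l = X l k := congrFun (congrFun hX l) k
  have hb_eq (l : ι) : b l = b i / X i j * X l j := by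
    rw [div_mul_eq_mul_div, eq_div_iff hij, ← hentry, ← hentry, hsymm]
  have hform : X = (b i / X i j) • vecMulVec (X.col j) (X.col j) := by
    ext k l
    rw [hentry, hb_eq l]
    simp only [Matrix.smul_apply, vecMulVec_apply, Matrix.col_apply, smul_eq_mul]
    ring
  refine ⟨b i / X i j, fun hc => hij ?_, hform⟩
  rw [hentry, hb_eq j, hc, zero_mul, zero_mul]

theorem Qapp_smul {F : Type*} [Field F] {n : ℕ} (Q X : Matrix (Fin n) (Fin n) F) (c : F) :
    Qapp Q (c • X) = c * Qapp Q X := by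
  simp only [Qapp, Matrix.smul_apply, smul_eq_mul, Finset.mul_sum, mul_left_comm]

theorem stmt9 {F : Type*} [Field F] [Fintype F] {q N n m : ℕ}
    (hq : Fintype.card F = q)
    (G : Matrix (Fin N) (Fin n) F)
    (hGinj : ∀ x : Fin n → F, G.mulVec x = 0 → x = 0)
    (d : ℕ) (hd : 1 ≤ d)
    (hG : ∀ y : Fin n → F, y ≠ 0 → d ≤ hw (G.mulVec y))
    (Q : Fin m → Matrix (Fin n) (Fin n) F)
    (hNoSol : ¬ ∃ a : Fin n → F, a ≠ 0 ∧ ∀ ℓ, Qapp (Q ℓ) (vecMulVec a a) = 0)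
    (X : Matrix (Fin n) (Fin n) F) (hXsym : Xᵀ = X) (hX0 : X ≠ 0)
    (hXQ : ∀ ℓ, Qapp (Q ℓ) X = 0) :
    G * X * Gᵀ ≠ 0 ∧ (q + 1) * d ^ 2 ≤ q * hwM (G * X * Gᵀ) := by
  classical
  subst hq
  obtain ⟨i, j, hij⟩ : ∃ i j, X i j ≠ 0 := by
    by_contra! h
    exact hX0 (Matrix.ext h)
  have ha : X.col j ≠ 0 := fun h => hij (congrFun h i)
  obtain ⟨l, hl⟩ : ∃ l, ∀ c : F, X.col l ≠ c • X.col j := by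
    by_contra! h
    obtain ⟨c, hc, hXc⟩ := exists_eq_smul_vecMulVec_self hXsym hij h
    refine hNoSol ⟨X.col j, ha, fun ℓ => ?_⟩
    have hQ := hXQ ℓ
    rw [hXc, Qapp_smul] at hQ
    exact (mul_eq_zero.mp hQ).resolve_left hc
  have hsupport := succ_card_mul_le_card_mul_support (G *ᵥ X.col j) (G *ᵥ X.col l) d
    (hG _ ha) fun c => by
      rw [← mulVec_smul, ← mulVec_add]
      refine hG _ fun h => hl (-c) ?_
      rw [neg_smul]
      exact eq_neg_of_add_eq_zero_left h
  have hrows : (∑ i, if (G *ᵥ X.col j) i ≠ 0 ∨ (G *ᵥ X.col l) i ≠ 0 then 1 else 0) * d ≤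
      hwM (G * X * Gᵀ) := by
    rw [hwM_eq_sum_hw, Finset.sum_mul]
    gcongr with i
    split_ifs with hi
    · have hrow : (G * X * Gᵀ) i = G *ᵥ (G * X) i := by
        ext k
        simp [Matrix.mul_apply, mulVec, dotProduct, mul_comm]
      rw [one_mul, hrow]
      refine hG _ fun h => ?_
      exact hi.elim (fun hj => hj (congrFun h j)) fun hl => hl (congrFun h l)
    · simp
  have hbound : (Fintype.card F + 1) * d ^ 2 ≤ Fintype.card F * hwM (G * X * Gᵀ) := by
    calc (Fintype.card F + 1) * d ^ 2 = (Fintype.card F + 1) * d * d := by ring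
      _ ≤ _ := Nat.mul_le_mul_right d hsupport
      _ ≤ _ := by
        rw [mul_assoc]
        exact Nat.mul_le_mul_left _ hrows
  refine ⟨fun hY => ?_, hbound⟩
  have hpos : 0 < (Fintype.card F + 1) * d ^ 2 := by positivity
  rw [hY] at hbound
  simp [hwM] at hbound
  omega
end
end

section
/- There exists a constant c₂ > 0 such that for every ε ∈ (0,1) and every δ ∈ (0, c₂·ε] the following holds. For each integer h with ⌈δh⌉ ≥ 2, set d := ⌈δ·h⌉ and let N := N(h) be the largest integer satisfying h·log(√d) ≥ d·log(N/d) (natural logarithms), equivalently N = ⌊d^{1+h/(2d)}⌋. Then the probability, under the uniform distribution on h×N sign matrices R ∈ {−1,1}^{h×N}, of the event that every pair of linearly independent vectors u, v ∈ ker(R) satisfies |supp(u) ∪ supp(v)| ≥ 2(1−ε)·d, tends to 1 as h → ∞. -/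
open Matrix

noncomputable section

/-- Probability of the event `P` under the uniform distribution on a finite type. -/
def prob {α : Type*} [Fintype α] (P : α → Prop) : ℝ :=
  ({a | P a} : Set α).ncard / Fintype.card α

/-- The `±1` sign matrix encoded by a Boolean matrix. -/
def signMat {h N : ℕ} (s : Fin h → Fin N → Bool) : Matrix (Fin h) (Fin N) ℝ :=
  fun i j => if s i j then 1 else -1

/-- `d = ⌈δ·h⌉`. -/
def dOf (δ : ℝ) (h : ℕ) : ℕ := ⌈δ * h⌉₊

/-- The largest `N` with `h·log √d ≥ d·log(N/d)`, i.e. `N = ⌊d^{1+h/(2d)}⌋`. -/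
def NOf (δ : ℝ) (h : ℕ) : ℕ :=
  ⌊(dOf δ h : ℝ) ^ ((1 : ℝ) + (h : ℝ) / (2 * (dOf δ h : ℝ)))⌋₊

/-! ### The uniform probability on a finite type -/

theorem prob_eq_card_filter {α : Type*} [Fintype α] (P : α → Prop) [DecidablePred P] :
    prob P = ((Finset.univ.filter P).card : ℝ) / Fintype.card α := by
  rw [prob, Set.ncard_eq_toFinset_card', Set.toFinset_ofPred]

theorem prob_nonneg {α : Type*} [Fintype α] (P : α → Prop) : 0 ≤ prob P := by
  unfold prob; positivity

theorem prob_le_one {α : Type*} [Fintype α] (P : α → Prop) : prob P ≤ 1 := by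
  classical
  rw [prob_eq_card_filter]
  exact div_le_one_of_le₀ (mod_cast Finset.card_le_univ _) (by positivity)

theorem prob_mono {α : Type*} [Fintype α] {P Q : α → Prop} (hPQ : ∀ a, P a → Q a) :
    prob P ≤ prob Q := by
  classical
  rw [prob_eq_card_filter, prob_eq_card_filter]
  gcongr
  exact hPQ _

theorem prob_not {α : Type*} [Fintype α] [Nonempty α] (P : α → Prop) :
    prob (fun a => ¬ P a) = 1 - prob P := by
  classical
  rw [prob_eq_card_filter, prob_eq_card_filter, eq_sub_iff_add_eq, ← add_div, div_eq_one_iff_eq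
    (by positivity), add_comm]
  exact_mod_cast Finset.card_filter_add_card_filter_not (s := Finset.univ) P

theorem prob_exists_mem_le {α ι : Type*} [Fintype α] (s : Finset ι) (P : ι → α → Prop) :
    prob (fun a => ∃ i ∈ s, P i a) ≤ ∑ i ∈ s, prob (P i) := by
  classical
  simp_rw [prob_eq_card_filter, ← Finset.sum_div]
  gcongr
  have : (Finset.univ.filter fun a => ∃ i ∈ s, P i a) ⊆
      s.biUnion fun i => Finset.univ.filter (P i) := by
    intro a; simp
  exact_mod_cast (Finset.card_le_card this).trans Finset.card_biUnion_le

theorem prob_or_le {α : Type*} [Fintype α] (P Q : α → Prop) :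
    prob (fun a => P a ∨ Q a) ≤ prob P + prob Q := by
  classical
  simp_rw [prob_eq_card_filter, ← add_div]
  gcongr
  rw [Finset.filter_or]
  exact_mod_cast Finset.card_union_le _ _

theorem prob_comp_equiv {α β : Type*} [Fintype α] [Fintype β] (e : α ≃ β) (P : β → Prop) :
    prob (fun a => P (e a)) = prob P := by
  classical
  rw [prob_eq_card_filter, prob_eq_card_filter, Fintype.card_congr e]
  congr 2
  rw [← Fintype.card_subtype, ← Fintype.card_subtype]
  exact Fintype.card_congr (e.subtypeEquiv fun _ => Iff.rfl)

theorem prob_prod_le {α β : Type*} [Fintype α] [Fintype β] (P : α → β → Prop) {c : ℝ}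
    (hc : 0 ≤ c) (hP : ∀ a, prob (P a) ≤ c) : prob (fun x : α × β => P x.1 x.2) ≤ c := by
  classical
  simp only [prob_eq_card_filter] at hP ⊢
  have hcard : ((Finset.univ.filter fun x : α × β => P x.1 x.2).card : ℝ) =
      ∑ a, ((Finset.univ.filter (P a)).card : ℝ) := by
    simp only [Finset.card_filter]
    push_cast
    rw [Fintype.sum_prod_type]
  refine div_le_of_le_mul₀ (by positivity) hc ?_
  rw [hcard, Fintype.card_prod]
  calc ∑ a, ((Finset.univ.filter (P a)).card : ℝ) ≤ ∑ _a : α, c * Fintype.card β := by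
        refine Finset.sum_le_sum fun a _ => ?_
        rcases isEmpty_or_nonempty β with hβ | hβ
        · simp
        · exact (div_le_iff₀ (by positivity)).1 (hP a)
    _ = c * ((Fintype.card α * Fintype.card β : ℕ) : ℝ) := by
        simp only [Finset.sum_const, Finset.card_univ, nsmul_eq_mul]; push_cast; ring

theorem prob_forall {ι B : Type*} [Fintype ι] [DecidableEq ι] [Fintype B] (Q : B → Prop) :
    prob (fun b : ι → B => ∀ i, Q (b i)) = prob Q ^ Fintype.card ι := by
  classical
  rw [prob_eq_card_filter, prob_eq_card_filter, div_pow, Fintype.card_fun]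
  have : (Finset.univ.filter fun b : ι → B => ∀ i, Q (b i)) =
      Fintype.piFinset fun _ => Finset.univ.filter Q := by
    ext; simp
  rw [this, Fintype.card_piFinset]
  simp

/-- If `φ b` lies in each subspace of the family `𝒢` with probability at most `q`, then `h`
independent samples all lie in a common member of `𝒢` with probability at most
`h ^ t * q ^ (h - t)`, where `t` bounds the dimension. -/
theorem prob_exists_submodule_le {K V B : Type*} [Field K] [AddCommGroup V] [Module K V]
    [FiniteDimensional K V] [Fintype B] (φ : B → V) (𝒢 : Set (Submodule K V)) {q : ℝ}
    (hq0 : 0 ≤ q) (hq : ∀ M ∈ 𝒢, prob (fun b => φ b ∈ M) ≤ q) {h t : ℕ} (ht : t ≤ h)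
    (hV : Module.finrank K V ≤ t) :
    prob (fun s : Fin h → B => ∃ M ∈ 𝒢, ∀ i, φ (s i) ∈ M) ≤ (h : ℝ) ^ t * q ^ (h - t) := by
  classical
  have hstep : ∀ s : Fin h → B, (∃ M ∈ 𝒢, ∀ i, φ (s i) ∈ M) →
      ∃ S ∈ Finset.powersetCard t (Finset.univ : Finset (Fin h)),
        ∀ M : Submodule K V, (∀ i ∈ S, φ (s i) ∈ M) → ∀ i, φ (s i) ∈ M := by
    intro s _
    obtain ⟨T, hTs, hTc, hTspan, -⟩ :=
      Submodule.exists_finset_span_eq_linearIndepOn K (Set.range fun i => φ (s i))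
    choose g hg using hTs
    have hcard : (T.attach.image fun x => g x.2).card ≤ t :=
      Finset.card_image_le.trans (T.card_attach.trans_le <|
        hTc.trans_le ((Submodule.finrank_le _).trans hV))
    obtain ⟨S, hTS, hS⟩ := Finset.exists_superset_card_eq hcard (by simpa using ht)
    refine ⟨S, by simp [Finset.mem_powersetCard, hS], fun M hM i => ?_⟩
    have hle : Submodule.span K (Set.range fun i => φ (s i)) ≤ M := by
      rw [← hTspan, Submodule.span_le]
      intro x hx
      have := hM (g hx) (hTS (Finset.mem_image_of_mem (fun x => g x.2) (T.mem_attach ⟨x, hx⟩)))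
      rwa [← hg hx]
    exact hle (Submodule.subset_span ⟨i, rfl⟩)
  have hS : ∀ S ∈ Finset.powersetCard t (Finset.univ : Finset (Fin h)),
      prob (fun s : Fin h → B => (∃ M ∈ 𝒢, ∀ i, φ (s i) ∈ M) ∧
        ∀ M : Submodule K V, (∀ i ∈ S, φ (s i) ∈ M) → ∀ i, φ (s i) ∈ M) ≤ q ^ (h - t) := by
    intro S hS
    have hSt : S.card = t := (Finset.mem_powersetCard.1 hS).2
    let G : ({i // i ∈ S} → B) → Prop := fun a => ∃ M ∈ 𝒢, ∀ i, φ (a i) ∈ M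
    let P : ({i // i ∈ S} → B) → ({i // ¬ i ∈ S} → B) → Prop := fun a b =>
      ∃ hG : G a, ∀ i, φ (b i) ∈ hG.choose
    refine le_trans (prob_mono (Q := fun s => P (Equiv.piEquivPiSubtypeProd (· ∈ S) _ s).1
      (Equiv.piEquivPiSubtypeProd (· ∈ S) _ s).2) ?_) ?_
    · rintro s ⟨⟨M, hM, hsM⟩, hs⟩
      have hG : G (Equiv.piEquivPiSubtypeProd (· ∈ S) (fun _ => B) s).1 :=
        ⟨M, hM, fun i => hsM i⟩
      exact ⟨hG, fun i => hs _ (fun j hj => hG.choose_spec.2 ⟨j, hj⟩) i⟩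
    · rw [prob_comp_equiv (Equiv.piEquivPiSubtypeProd (· ∈ S) (fun _ => B))
        (fun x => P x.1 x.2)]
      refine prob_prod_le P (by positivity) fun a => ?_
      by_cases hG : G a
      · refine (prob_mono (Q := fun b => ∀ i, φ (b i) ∈ hG.choose) fun b hb => hb.2).trans ?_
        rw [prob_forall (fun b => φ b ∈ hG.choose), Fintype.card_subtype_compl,
          Fintype.card_fin, Fintype.card_coe, hSt]
        exact pow_le_pow_left₀ (prob_nonneg _) (hq _ hG.choose_spec.1) _
      · have : prob (P a) = 0 := by simp [prob, P, hG]
        rw [this]; positivity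
  calc _ ≤ prob (fun s : Fin h → B => ∃ S ∈ Finset.powersetCard t (Finset.univ : Finset (Fin h)),
          (∃ M ∈ 𝒢, ∀ i, φ (s i) ∈ M) ∧
          ∀ M : Submodule K V, (∀ i ∈ S, φ (s i) ∈ M) → ∀ i, φ (s i) ∈ M) := by
        refine prob_mono fun s hs => ?_
        obtain ⟨S, hS, hS'⟩ := hstep s hs
        exact ⟨S, hS, hs, hS'⟩
    _ ≤ _ := prob_exists_mem_le _ _
    _ ≤ ∑ _S ∈ Finset.powersetCard t (Finset.univ : Finset (Fin h)), q ^ (h - t) :=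
        Finset.sum_le_sum hS
    _ ≤ _ := by
        rw [Finset.sum_const, Finset.card_powersetCard, Finset.card_univ, Fintype.card_fin,
          nsmul_eq_mul]
        gcongr
        exact_mod_cast Nat.choose_le_pow h t


/-! ### Anticoncentration of random signs over `ZMod p` -/

/-- The sign `±1` encoded by a Boolean, in an arbitrary ring. -/
def boolSign (R : Type*) [Ring R] (b : Bool) : R := if b then 1 else -1

/-- The real part of the standard additive character, i.e. `x ↦ cos (2πx/p)` on `ZMod p`. -/
def cosChar (p : ℕ) [NeZero p] (x : ZMod p) : ℝ := (ZMod.stdAddChar x).re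

section SignSums

variable {p : ℕ} [Fact p.Prime]

theorem stdAddChar_add_stdAddChar_neg (x : ZMod p) :
    (ZMod.stdAddChar x + ZMod.stdAddChar (-x) : ℂ) = 2 * (cosChar p x : ℂ) := by
  rw [AddChar.map_neg_eq_conj, Complex.add_conj, cosChar]
  push_cast; ring

theorem abs_cosChar_le_one (x : ZMod p) : |cosChar p x| ≤ 1 :=
  (Complex.abs_re_le_norm _).trans_eq (AddChar.norm_apply _ _)

theorem map_sum_stdAddChar {ι : Type*} [Fintype ι] (f : ι → ZMod p) :
    (ZMod.stdAddChar (∑ i, f i) : ℂ) = ∏ i, ZMod.stdAddChar (f i) := by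
  have := map_prod (ZMod.stdAddChar (N := p)).toMonoidHom
    (fun i => Multiplicative.ofAdd (f i)) Finset.univ
  rwa [← ofAdd_sum] at this

theorem sum_stdAddChar_signs {ι : Type*} [Fintype ι] [DecidableEq ι] (w : ι → ZMod p) :
    ∑ r : ι → Bool, (ZMod.stdAddChar (∑ i, boolSign (ZMod p) (r i) * w i) : ℂ) =
      2 ^ Fintype.card ι * ((∏ i, cosChar p (w i) : ℝ) : ℂ) := by
  classical
  have h : ∀ i, ∑ b : Bool, (ZMod.stdAddChar (boolSign (ZMod p) b * w i) : ℂ) =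
      2 * (cosChar p (w i) : ℂ) := by
    intro i
    simp [boolSign, stdAddChar_add_stdAddChar_neg]
  have h2 := Finset.prod_univ_sum (fun _ : ι => (Finset.univ : Finset Bool))
    (fun i b => (ZMod.stdAddChar (boolSign (ZMod p) b * w i) : ℂ))
  simp only [h, Fintype.piFinset_univ] at h2
  simp_rw [map_sum_stdAddChar]
  rw [← h2, Finset.prod_mul_distrib]
  simp

theorem prob_two_linear_eq {ι : Type*} [Fintype ι] [DecidableEq ι] (u v : ι → ZMod p) :
    prob (fun r : ι → Bool => ∑ i, boolSign (ZMod p) (r i) * u i = 0 ∧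
      ∑ i, boolSign (ZMod p) (r i) * v i = 0) =
      (∑ x : ZMod p, ∑ y : ZMod p, ∏ i, cosChar p (x * u i + y * v i)) / (p : ℝ) ^ 2 := by
  classical
  have hp : (p : ℝ) ≠ 0 := mod_cast (Fact.out : p.Prime).ne_zero
  have key : (∑ x : ZMod p, ∑ y : ZMod p, (2 : ℂ) ^ Fintype.card ι *
      ((∏ i, cosChar p (x * u i + y * v i) : ℝ) : ℂ)) =
      (p : ℂ) ^ 2 * ((Finset.univ.filter fun r : ι → Bool =>
        ∑ i, boolSign (ZMod p) (r i) * u i = 0 ∧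
        ∑ i, boolSign (ZMod p) (r i) * v i = 0).card : ℂ) := by
    simp_rw [← sum_stdAddChar_signs]
    have hsplit : ∀ (x y : ZMod p) (r : ι → Bool),
        (ZMod.stdAddChar (∑ i, boolSign (ZMod p) (r i) * (x * u i + y * v i)) : ℂ) =
        ZMod.stdAddChar (x * ∑ i, boolSign (ZMod p) (r i) * u i) *
        ZMod.stdAddChar (y * ∑ i, boolSign (ZMod p) (r i) * v i) := by
      intro x y r
      rw [← AddChar.map_add_eq_mul, Finset.mul_sum, Finset.mul_sum, ← Finset.sum_add_distrib]
      congr 1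
      exact Finset.sum_congr rfl fun i _ => by ring
    simp_rw [hsplit]
    have hcomm : ∀ x : ZMod p, ∑ y : ZMod p, ∑ r : ι → Bool,
        (ZMod.stdAddChar (x * ∑ i, boolSign (ZMod p) (r i) * u i) *
        ZMod.stdAddChar (y * ∑ i, boolSign (ZMod p) (r i) * v i) : ℂ) =
        ∑ r : ι → Bool, (ZMod.stdAddChar (x * ∑ i, boolSign (ZMod p) (r i) * u i) : ℂ) *
        ∑ y : ZMod p, (ZMod.stdAddChar (y * ∑ i, boolSign (ZMod p) (r i) * v i) : ℂ) := by
      intro x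
      rw [Finset.sum_comm]
      simp_rw [Finset.mul_sum]
    simp_rw [hcomm]
    rw [Finset.sum_comm]
    simp_rw [← Finset.sum_mul, AddChar.sum_mulShift _ (ZMod.isPrimitive_stdAddChar p), ZMod.card]
    rw [Finset.card_filter]
    push_cast
    rw [Finset.mul_sum]
    refine Finset.sum_congr rfl fun r _ => ?_
    split_ifs <;> simp_all [sq]
  rw [prob_eq_card_filter, Fintype.card_fun, Fintype.card_bool, div_eq_div_iff (by positivity)
    (by positivity)]
  have key' := congrArg Complex.re key
  simp_rw [← Finset.mul_sum] at key'
  norm_cast at key'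
  push_cast at key' ⊢
  linarith

theorem sum_cosChar_pow {l : ℕ} (hl : 2 * l < p) (hp : p ≠ 2) :
    (∑ x : ZMod p, cosChar p x ^ (2 * l)) / p = (l.centralBinom : ℝ) / 4 ^ l := by
  have hp0 : (p : ℝ) ≠ 0 := mod_cast (Fact.out : p.Prime).ne_zero
  have key : (∑ x : ZMod p, (4 : ℂ) ^ l * ((cosChar p x : ℂ) ^ (2 * l))) =
      (p : ℂ) * (l.centralBinom : ℂ) := by
    have hx : ∀ x : ZMod p, (4 : ℂ) ^ l * ((cosChar p x : ℂ) ^ (2 * l)) =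
        ∑ m ∈ Finset.range (2 * l + 1),
          (ZMod.stdAddChar (x * (2 * ((m : ZMod p) - (l : ZMod p)))) : ℂ) *
            ((2 * l).choose m : ℂ) := by
      intro x
      rw [show (4 : ℂ) = 2 ^ 2 by norm_num, ← pow_mul, ← mul_pow,
        ← stdAddChar_add_stdAddChar_neg, add_pow]
      refine Finset.sum_congr rfl fun m hm => ?_
      rw [← AddChar.map_nsmul_eq_pow, ← AddChar.map_nsmul_eq_pow, ← AddChar.map_add_eq_mul]
      congr 2
      have : m ≤ 2 * l := by simpa [Nat.lt_succ_iff] using hm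
      simp only [nsmul_eq_mul]
      push_cast [this]
      ring
    simp_rw [hx]
    rw [Finset.sum_comm]
    simp_rw [← Finset.sum_mul, AddChar.sum_mulShift _ (ZMod.isPrimitive_stdAddChar p), ZMod.card]
    rw [Finset.sum_eq_single l]
    · simp [Nat.centralBinom]
    · intro m hm hml
      have hm' : m ≤ 2 * l := by simpa [Nat.lt_succ_iff] using hm
      rw [if_neg]
      · simp
      · have h2 : (2 : ZMod p) ≠ 0 := by
          intro h
          have : p ∣ 2 := (ZMod.natCast_eq_zero_iff 2 p).1 (by exact_mod_cast h)
          exact hp ((Nat.prime_dvd_prime_iff_eq Fact.out Nat.prime_two).1 this)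
        refine mul_ne_zero h2 (sub_ne_zero.2 fun h => hml ?_)
        have := (ZMod.natCast_eq_natCast_iff' m l p).1 h
        rwa [Nat.mod_eq_of_lt (by omega), Nat.mod_eq_of_lt (by omega)] at this
    · intro h; simp at h; omega
  have key' := congrArg Complex.re key
  simp_rw [← Finset.mul_sum] at key'
  norm_cast at key'
  rw [div_eq_div_iff hp0 (by positivity)]
  push_cast at key'
  linarith

theorem centralBinom_sq_mul_le (l : ℕ) : (2 * l + 1) * l.centralBinom ^ 2 ≤ 16 ^ l := by
  induction l with
  | zero => simp
  | succ n ih =>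
    have h := Nat.succ_mul_centralBinom_succ n
    refine Nat.le_of_mul_le_mul_left (c := (n + 1) ^ 2) ?_ (by positivity)
    calc (n + 1) ^ 2 * ((2 * (n + 1) + 1) * (n + 1).centralBinom ^ 2)
        = (2 * n + 3) * ((n + 1) * (n + 1).centralBinom) ^ 2 := by ring
      _ = 4 * (2 * n + 3) * (2 * n + 1) * ((2 * n + 1) * n.centralBinom ^ 2) := by rw [h]; ring
      _ ≤ 4 * (2 * n + 3) * (2 * n + 1) * 16 ^ n := by gcongr
      _ ≤ (16 * (n + 1) ^ 2) * 16 ^ n := Nat.mul_le_mul_right _ (by nlinarith)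
      _ = _ := by ring

theorem centralBinom_div_sq_le (l : ℕ) :
    ((l.centralBinom : ℝ) / 4 ^ l) ^ 2 ≤ 1 / (2 * l + 1) := by
  rw [div_pow, ← pow_mul, mul_comm l 2, pow_mul, div_le_div_iff₀ (by positivity) (by positivity)]
  have := centralBinom_sq_mul_le l
  norm_num
  rw [mul_comm]
  exact_mod_cast this

theorem prod_le_sum_pow_div {m : ℕ} (hm : m ≠ 0) (x : Fin m → ℝ) (hx : ∀ i, 0 ≤ x i) :
    ∏ i, x i ≤ (∑ i, x i ^ m) / m := by
  have h := Real.geom_mean_le_arith_mean_weighted Finset.univ (fun _ => (1 / m : ℝ))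
    (fun i => x i ^ m) (fun _ _ => by positivity) (by simp [hm])
    (fun i _ => pow_nonneg (hx i) m)
  rw [← Finset.mul_sum] at h
  simp only [one_div, Real.pow_rpow_inv_natCast (hx _) hm] at h
  rwa [div_eq_inv_mul]

theorem prod_cosChar_le {ι κ : Type*} [Fintype ι] [Fintype κ] (e : κ → ι)
    (he : Function.Injective e) (w : ι → ZMod p) :
    ∏ i, cosChar p (w i) ≤ ∏ k, |cosChar p (w (e k))| := by
  classical
  calc ∏ i, cosChar p (w i) ≤ |∏ i, cosChar p (w i)| := le_abs_self _
    _ = ∏ i, |cosChar p (w i)| := Finset.abs_prod _ _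
    _ = (∏ i ∈ Finset.univ.image e, |cosChar p (w i)|) *
        ∏ i ∈ (Finset.univ.image e)ᶜ, |cosChar p (w i)| := by
          rw [Finset.prod_mul_prod_compl]
    _ ≤ (∏ i ∈ Finset.univ.image e, |cosChar p (w i)|) * 1 := by
          refine mul_le_mul_of_nonneg_left ?_ (Finset.prod_nonneg fun _ _ => abs_nonneg _)
          exact Finset.prod_le_one (fun _ _ => abs_nonneg _) fun _ _ => abs_cosChar_le_one _
    _ = _ := by rw [mul_one, Finset.prod_image he.injOn]

/-- Halász-type bound: if the vectors `(u i, v i)` contain `2 * l` disjoint pairs of linearly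
independent vectors, then a random signed sum of them vanishes with probability at most
`1 / (2 * l + 1)`. -/
theorem prob_two_linear_le {ι : Type*} [Fintype ι] [DecidableEq ι] (u v : ι → ZMod p)
    {l : ℕ} (hl : 2 * l < p)
    (hp : p ≠ 2) (e : Fin (2 * l) ⊕ Fin (2 * l) → ι) (he : Function.Injective e)
    (hdet : ∀ j, u (e (.inl j)) * v (e (.inr j)) - u (e (.inr j)) * v (e (.inl j)) ≠ 0) :
    prob (fun r : ι → Bool => ∑ i, boolSign (ZMod p) (r i) * u i = 0 ∧
      ∑ i, boolSign (ZMod p) (r i) * v i = 0) ≤ 1 / (2 * l + 1) := by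
  rcases Nat.eq_zero_or_pos l with rfl | hl0
  · simpa using prob_le_one _
  have hp0 : (0 : ℝ) < p := mod_cast (Fact.out : p.Prime).pos
  refine le_trans ?_ (centralBinom_div_sq_le l)
  rw [prob_two_linear_eq, ← sum_cosChar_pow hl hp, div_pow]
  gcongr
  have hpair : ∀ j : Fin (2 * l), ∑ x : ZMod p, ∑ y : ZMod p,
      (|cosChar p (x * u (e (.inl j)) + y * v (e (.inl j)))| *
        |cosChar p (x * u (e (.inr j)) + y * v (e (.inr j)))|) ^ (2 * l) =
      (∑ x : ZMod p, cosChar p x ^ (2 * l)) ^ 2 := by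
    intro j
    generalize e (.inl j) = i₁, e (.inr j) = i₂, hdet j = hD at *
    set a := u i₁
    set b := v i₁
    set c := u i₂
    set d := v i₂
    have hinj : Function.Injective fun z : ZMod p × ZMod p =>
        (z.1 * a + z.2 * b, z.1 * c + z.2 * d) := by
      rintro ⟨x, y⟩ ⟨x', y'⟩ h
      simp only [Prod.mk.injEq] at h ⊢
      obtain ⟨h1, h2⟩ := h
      constructor
      · refine sub_eq_zero.1 ((mul_eq_zero.1 (?_ : (x - x') * (a * d - c * b) = 0)).resolve_right hD)
        linear_combination d * h1 - b * h2
      · refine sub_eq_zero.1 ((mul_eq_zero.1 (?_ : (y - y') * (a * d - c * b) = 0)).resolve_right hD)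
        linear_combination a * h2 - c * h1
    rw [sq, Finset.sum_mul_sum, ← Fintype.sum_prod_type', ← Fintype.sum_prod_type']
    refine Fintype.sum_bijective _ (Finite.injective_iff_bijective.1 hinj) _ _ fun z => ?_
    simp only [mul_pow, Even.pow_abs (even_two_mul l)]
  calc ∑ x : ZMod p, ∑ y : ZMod p, ∏ i, cosChar p (x * u i + y * v i)
      ≤ ∑ x : ZMod p, ∑ y : ZMod p, (∑ j : Fin (2 * l),
        (|cosChar p (x * u (e (.inl j)) + y * v (e (.inl j)))| *
        |cosChar p (x * u (e (.inr j)) + y * v (e (.inr j)))|) ^ (2 * l)) / (2 * l : ℕ) := by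
        gcongr with x _ y _
        refine (prod_cosChar_le e he fun i => x * u i + y * v i).trans ?_
        rw [Fintype.prod_sum_type, ← Finset.prod_mul_distrib]
        exact prod_le_sum_pow_div (by omega) _ fun _ => by positivity
    _ = (∑ j : Fin (2 * l), ∑ x : ZMod p, ∑ y : ZMod p,
        (|cosChar p (x * u (e (.inl j)) + y * v (e (.inl j)))| *
        |cosChar p (x * u (e (.inr j)) + y * v (e (.inr j)))|) ^ (2 * l)) / (2 * l : ℕ) := by
        simp_rw [← Finset.sum_div]
        congr 1
        rw [Finset.sum_comm]
        refine Eq.trans ?_ Finset.sum_comm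
        rw [Finset.sum_comm]
        exact Finset.sum_congr rfl fun _ _ => Finset.sum_comm
    _ = _ := by
        simp_rw [hpair]
        rw [Finset.sum_const, Finset.card_univ, Fintype.card_fin, nsmul_eq_mul,
          mul_div_cancel_left₀ _ (by positivity)]

theorem prob_linear_sq_le {ι : Type*} [Fintype ι] [DecidableEq ι] (u : ι → ZMod p)
    {l : ℕ} (hl : 2 * l < p)
    (hp : p ≠ 2) (e : Fin (2 * l) → ι) (he : Function.Injective e) (hu : ∀ j, u (e j) ≠ 0) :
    prob (fun r : ι → Bool => ∑ i, boolSign (ZMod p) (r i) * u i = 0) ^ 2 ≤ 1 / (2 * l + 1) := by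
  rcases Nat.eq_zero_or_pos l with rfl | hl0
  · simp only [mul_zero, Nat.cast_zero, zero_add, div_one]
    exact pow_le_one₀ (prob_nonneg _) (prob_le_one _)
  have hp0 : (0 : ℝ) < p := mod_cast (Fact.out : p.Prime).pos
  refine le_trans (pow_le_pow_left₀ (prob_nonneg _) ?_ 2) (centralBinom_div_sq_le l)
  have h0 := prob_two_linear_eq u (fun _ => 0)
  simp only [mul_zero, Finset.sum_const_zero, and_true, add_zero, Finset.sum_const,
    Finset.card_univ, ZMod.card, nsmul_eq_mul] at h0
  rw [h0, ← sum_cosChar_pow hl hp, ← Finset.mul_sum, sq, mul_div_mul_left _ _ hp0.ne']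
  refine div_le_div_of_nonneg_right ?_ hp0.le
  calc ∑ x : ZMod p, ∏ i, cosChar p (x * u i)
      ≤ ∑ x : ZMod p, (∑ j : Fin (2 * l), |cosChar p (x * u (e j))| ^ (2 * l)) / (2 * l : ℕ) := by
        gcongr with x _
        refine (prod_cosChar_le e he fun i => x * u i).trans ?_
        exact prod_le_sum_pow_div (by omega) _ fun _ => by positivity
    _ = (∑ j : Fin (2 * l), ∑ x : ZMod p, cosChar p (x * u (e j)) ^ (2 * l)) / (2 * l : ℕ) := by
        simp_rw [← Finset.sum_div, Even.pow_abs (even_two_mul l)]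
        rw [Finset.sum_comm]
    _ = (∑ _j : Fin (2 * l), ∑ x : ZMod p, cosChar p x ^ (2 * l)) / (2 * l : ℕ) := by
        congr 1
        refine Finset.sum_congr rfl fun j _ => ?_
        exact Fintype.sum_bijective _ (mul_left_injective₀ (hu j)).bijective_of_finite _ _
          fun _ => rfl
    _ = _ := by
        rw [Finset.sum_const, Finset.card_univ, Fintype.card_fin, nsmul_eq_mul,
          mul_div_cancel_left₀ _ (by positivity)]


theorem exists_disjoint_pairs {α : Type*} (T : Finset α) (f : α → ℕ) {k : ℕ}
    (hk : 2 * k ≤ T.card) (hf : ∀ a, (T.filter fun i => f i = a).card ≤ k) :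
    ∃ e : Fin k ⊕ Fin k → α, Function.Injective e ∧ (∀ x, e x ∈ T) ∧
      ∀ j, f (e (.inl j)) ≠ f (e (.inr j)) := by
  classical
  let F : Fin T.card → ℕ := fun i => f (T.equivFin.symm i)
  let g : Fin T.card → α := fun i => T.equivFin.symm (Tuple.sort F i)
  have hg : Function.Injective g :=
    Subtype.val_injective.comp (T.equivFin.symm.injective.comp (Tuple.sort F).injective)
  have hgT : ∀ i, g i ∈ T := fun i => (T.equivFin.symm (Tuple.sort F i)).2
  have hmono : Monotone fun i => f (g i) := Tuple.monotone_sort F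
  let c : Fin k ⊕ Fin k → Fin T.card :=
    Sum.elim (fun j => ⟨j, by omega⟩) (fun j => ⟨j + k, by omega⟩)
  have hc : Function.Injective c := by
    rintro (i | i) (j | j) h <;> simp [c, Fin.ext_iff] at h ⊢ <;> omega
  refine ⟨g ∘ c, hg.comp hc, fun x => hgT _, fun j hj => ?_⟩
  have hsub : (Finset.Icc (c (.inl j)) (c (.inr j))).image g ⊆
      T.filter fun i => f i = f (g (c (.inl j))) := by
    intro a ha
    obtain ⟨i, hi, rfl⟩ := Finset.mem_image.1 ha
    rw [Finset.mem_Icc] at hi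
    exact Finset.mem_filter.2 ⟨hgT i, le_antisymm ((hmono hi.2).trans_eq hj.symm) (hmono hi.1)⟩
  have := (Finset.card_le_card hsub).trans (hf _)
  rw [Finset.card_image_of_injective _ hg, Fin.card_Icc] at this
  simp [c] at this
  omega

/-- The projective class of `(x, y)`, encoded as a natural number. -/
def projClass (x y : ZMod p) : ℕ := if y = 0 then p else (x / y).val

theorem projClass_eq_projClass_iff {a b c d : ZMod p} (hab : a ≠ 0 ∨ b ≠ 0) (hcd : c ≠ 0 ∨ d ≠ 0) :
    projClass a b = projClass c d ↔ a * d - c * b = 0 := by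
  unfold projClass
  have h1 := ZMod.val_lt (a / b)
  have h2 := ZMod.val_lt (c / d)
  split_ifs with hb hd hd
  · simp [hb, hd]
  · have ha : a ≠ 0 := by tauto
    simp [hb, hd, ha, h2.ne']
  · have hc : c ≠ 0 := by tauto
    simp [hb, hd, hc, h1.ne]
  · rw [(ZMod.val_injective p).eq_iff, div_eq_div_iff hb hd, sub_eq_zero]

/-- If no line contains more than half of the vectors `(u i, v i)`, `i ∈ T`, then a random signed
sum vanishes with probability at most `4 / |T|`. -/
theorem prob_two_linear_le_of_spread {ι : Type*} [Fintype ι] [DecidableEq ι] (u v : ι → ZMod p)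
    (T : Finset ι) (hT0 : 0 < T.card) (hTp : T.card < p) (hp : p ≠ 2)
    (hT : ∀ i ∈ T, u i ≠ 0 ∨ v i ≠ 0)
    (hs : ∀ x y : ZMod p, x ≠ 0 ∨ y ≠ 0 →
      2 * (T.filter fun i => x * u i + y * v i = 0).card ≤ T.card) :
    prob (fun r : ι → Bool => ∑ i, boolSign (ZMod p) (r i) * u i = 0 ∧
      ∑ i, boolSign (ZMod p) (r i) * v i = 0) ≤ 4 / T.card := by
  obtain ⟨e, he, heT, hne⟩ := exists_disjoint_pairs T (fun i => projClass (u i) (v i))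
    (k := T.card / 2) (by omega) (fun a => by
      rcases (T.filter fun i => projClass (u i) (v i) = a).eq_empty_or_nonempty with h | ⟨i₀, hi₀⟩
      · simp [h]
      · obtain ⟨hi₀T, rfl⟩ := Finset.mem_filter.1 hi₀
        have h1 := hs (v i₀) (-u i₀) (by simpa [or_comm] using hT i₀ hi₀T)
        have h2 : (T.filter fun i => projClass (u i) (v i) = projClass (u i₀) (v i₀)) ⊆
            T.filter fun i => v i₀ * u i + -u i₀ * v i = 0 := by
          intro i hi
          obtain ⟨hiT, hi⟩ := Finset.mem_filter.1 hi
          refine Finset.mem_filter.2 ⟨hiT, ?_⟩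
          have := (projClass_eq_projClass_iff (hT i hiT) (hT i₀ hi₀T)).1 hi
          linear_combination this
        have := Finset.card_le_card h2
        omega)
  have hl : 2 * (T.card / 4) ≤ T.card / 2 := by omega
  refine (prob_two_linear_le u v (l := T.card / 4) (by omega) hp
    (e ∘ Sum.map (Fin.castLE hl) (Fin.castLE hl))
    (he.comp ((Fin.castLE_injective hl).sumMap (Fin.castLE_injective hl))) fun j => ?_).trans ?_
  · have := hne (Fin.castLE hl j)
    rwa [Ne, projClass_eq_projClass_iff (hT _ (heT _)) (hT _ (heT _))] at this
  · rw [div_le_div_iff₀ (by positivity) (by positivity)]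
    have : T.card ≤ 4 * (2 * (T.card / 4) + 1) := by omega
    have : (T.card : ℝ) ≤ 4 * (2 * ((T.card / 4 : ℕ) : ℝ) + 1) := mod_cast this
    linarith

theorem prob_linear_le {ι : Type*} [Fintype ι] [DecidableEq ι] (u : ι → ZMod p)
    (T : Finset ι) (hT0 : 0 < T.card) (hTp : T.card < p) (hp : p ≠ 2) (hT : ∀ i ∈ T, u i ≠ 0) :
    prob (fun r : ι → Bool => ∑ i, boolSign (ZMod p) (r i) * u i = 0) ≤ 1 / √T.card := by
  have hl : 2 * (T.card / 2) ≤ T.card := by omega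
  have h := prob_linear_sq_le u (l := T.card / 2) (by omega) hp
    (fun j => T.equivFin.symm (Fin.castLE hl j))
    (Subtype.val_injective.comp (T.equivFin.symm.injective.comp (Fin.castLE_injective hl)))
    fun j => hT _ (T.equivFin.symm _).2
  refine le_of_sq_le_sq (h.trans ?_) (by positivity)
  rw [div_pow, one_pow, Real.sq_sqrt (by positivity)]
  have : T.card ≤ 2 * (T.card / 2) + 1 := by omega
  gcongr
  exact_mod_cast this

/-! ### Reduction of kernels modulo `p` -/

theorem rank_map_zmod_le_rank_map_real {m n : Type*} [Fintype m] [Fintype n] [DecidableEq n]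
    (A : Matrix m n ℤ) :
    (A.map ((↑) : ℤ → ZMod p)).rank ≤ (A.map ((↑) : ℤ → ℝ)).rank := by
  classical
  obtain ⟨κ, a, ha, hspan, hli⟩ := exists_linearIndependent' (ZMod p) (A.map ((↑) : ℤ → ZMod p)).row
  have : Finite κ := Finite.of_injective a ha
  have := Fintype.ofFinite κ
  let C : Matrix κ n ℤ := A.submatrix a id
  have hCrank : (C.map ((↑) : ℤ → ZMod p)).rank = Fintype.card κ := hli.rank_matrix
  have hrank : (A.map ((↑) : ℤ → ZMod p)).rank = Fintype.card κ := by
    rw [Matrix.rank_eq_finrank_span_row, ← hspan, finrank_span_eq_card hli]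
  have hsurj : Function.Surjective (C.map ((↑) : ℤ → ZMod p)).mulVec := by
    have : LinearMap.range (C.map ((↑) : ℤ → ZMod p)).mulVecLin = ⊤ :=
      Submodule.eq_top_of_finrank_eq (by rw [← Matrix.rank, hCrank]; simp)
    exact LinearMap.range_eq_top.1 this
  obtain ⟨X, hX⟩ := Matrix.mulVec_surjective_iff_exists_right_inverse.1 hsurj
  let Y : Matrix n κ ℤ := X.map fun x => (x.val : ℤ)
  have hY : Y.map ((↑) : ℤ → ZMod p) = X := by
    ext i j; simp [Y]
  have hdet : (C * Y).det ≠ 0 := by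
    intro h
    have h' := congrArg (Int.castRingHom (ZMod p)) h
    rw [RingHom.map_det, RingHom.mapMatrix_apply, Matrix.map_mul] at h'
    simp only [Int.coe_castRingHom, hY, hX] at h'
    simp at h'
  have hdetR : (C.map ((↑) : ℤ → ℝ) * Y.map ((↑) : ℤ → ℝ)).det ≠ 0 := by
    have h' : (C.map ((↑) : ℤ → ℝ) * Y.map ((↑) : ℤ → ℝ)).det =
        Int.castRingHom ℝ (C * Y).det := by
      rw [RingHom.map_det, RingHom.mapMatrix_apply, Matrix.map_mul]; rfl
    rw [h']
    simpa using hdet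
  calc _ = Fintype.card κ := hrank
    _ = (C.map ((↑) : ℤ → ℝ) * Y.map ((↑) : ℤ → ℝ)).rank :=
      (Matrix.rank_of_det_ne_zero hdetR).symm
    _ ≤ (C.map ((↑) : ℤ → ℝ)).rank := Matrix.rank_mul_le_left _ _
    _ ≤ _ := Matrix.rank_submatrix_le (A.map ((↑) : ℤ → ℝ)) a id

theorem rank_add_two_le {K m n : Type*} [Field K] [Fintype n] (B : Matrix m n K)
    {u v : n → K} (hu : B.mulVec u = 0) (hv : B.mulVec v = 0)
    (huv : LinearIndependent K ![u, v]) : B.rank + 2 ≤ Fintype.card n := by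
  have h1 := LinearMap.finrank_range_add_finrank_ker B.mulVecLin
  rw [Module.finrank_fintype_fun_eq_card] at h1
  rw [Matrix.rank, ← h1, ← (finrank_span_eq_card huv).trans (Fintype.card_fin 2)]
  gcongr
  refine Submodule.finrank_mono (Submodule.span_le.2 ?_)
  rintro _ ⟨i, rfl⟩
  fin_cases i
  · exact hu
  · exact hv

theorem exists_kernel_pair {K m n : Type*} [Field K] [Fintype n] (B : Matrix m n K)
    (hB : B.rank + 2 ≤ Fintype.card n) :
    ∃ u v : n → K, B.mulVec u = 0 ∧ B.mulVec v = 0 ∧ LinearIndependent K ![u, v] := by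
  have h1 := LinearMap.finrank_range_add_finrank_ker B.mulVecLin
  rw [Module.finrank_fintype_fun_eq_card, ← Matrix.rank] at h1
  have h2 : 1 < Module.finrank K (LinearMap.ker B.mulVecLin) := by omega
  have : Nontrivial (LinearMap.ker B.mulVecLin) :=
    Module.nontrivial_of_finrank_pos (R := K) (zero_lt_one.trans h2)
  obtain ⟨x, hx⟩ := exists_ne (0 : LinearMap.ker B.mulVecLin)
  obtain ⟨y, hxy⟩ := exists_linearIndependent_pair_of_one_lt_finrank h2 hx
  refine ⟨x, y, x.2, y.2, ?_⟩
  have hxy' := hxy.map' (Submodule.subtype _) (Submodule.ker_subtype _)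
  have hcomp : Submodule.subtype _ ∘ ![x, y] = ![(x : n → K), y] := by
    ext i; fin_cases i <;> rfl
  rwa [hcomp] at hxy'

theorem exists_zmod_kernel_pair {m n : Type*} [Fintype m] [Fintype n] [DecidableEq n]
    (A : Matrix m n ℤ) {u v : n → ℝ} (hu : (A.map ((↑) : ℤ → ℝ)).mulVec u = 0)
    (hv : (A.map ((↑) : ℤ → ℝ)).mulVec v = 0) (huv : LinearIndependent ℝ ![u, v]) :
    ∃ u' v' : n → ZMod p, (A.map ((↑) : ℤ → ZMod p)).mulVec u' = 0 ∧
      (A.map ((↑) : ℤ → ZMod p)).mulVec v' = 0 ∧ LinearIndependent (ZMod p) ![u', v'] :=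
  exists_kernel_pair _ ((Nat.add_le_add_right (rank_map_zmod_le_rank_map_real A) 2).trans
    (rank_add_two_le _ hu hv huv))

theorem exists_zmod_signs_kernel_pair {h N : ℕ} (s : Fin h → Fin N → Bool) {u v : Fin N → ℝ}
    (hu : (signMat s).mulVec u = 0) (hv : (signMat s).mulVec v = 0)
    (huv : LinearIndependent ℝ ![u, v]) :
    ∃ u' v' : Fin N → ZMod p, (∀ i, ∑ j, boolSign (ZMod p) (s i j) * u' j = 0) ∧
      (∀ i, ∑ j, boolSign (ZMod p) (s i j) * v' j = 0) ∧ LinearIndependent (ZMod p) ![u', v'] ∧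
      ∀ j, u' j ≠ 0 ∨ v' j ≠ 0 → u j ≠ 0 ∨ v j ≠ 0 := by
  classical
  let A : Matrix (Fin h ⊕ Fin N) (Fin N) ℤ := Matrix.fromRows
    (Matrix.of fun i j => boolSign ℤ (s i j))
    (Matrix.diagonal fun j => if u j ≠ 0 ∨ v j ≠ 0 then 0 else 1)
  have hcast : ∀ (R : Type) [Ring R] (b : Bool), ((boolSign ℤ b : ℤ) : R) = boolSign R b := by
    intro R _ b; cases b <;> simp [boolSign]
  have hker : ∀ (w : Fin N → ℝ), (signMat s).mulVec w = 0 →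
      (∀ j, ¬ (u j ≠ 0 ∨ v j ≠ 0) → w j = 0) → (A.map ((↑) : ℤ → ℝ)).mulVec w = 0 := by
    intro w hw hw0
    ext (i | j)
    · have := congrFun hw i
      simpa [A, Matrix.mulVec, dotProduct, hcast, signMat, boolSign] using this
    · by_cases hj : u j ≠ 0 ∨ v j ≠ 0
      · simp [A, Matrix.mulVec, dotProduct, Matrix.diagonal_apply, hj]
      · simp [A, Matrix.mulVec, dotProduct, Matrix.diagonal_apply, hj, hw0 j hj]
  have hkerp : ∀ (w : Fin N → ZMod p), (A.map ((↑) : ℤ → ZMod p)).mulVec w = 0 →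
      (∀ i, ∑ j, boolSign (ZMod p) (s i j) * w j = 0) ∧
      ∀ j, w j ≠ 0 → u j ≠ 0 ∨ v j ≠ 0 := by
    intro w hw
    refine ⟨fun i => ?_, fun j hj => ?_⟩
    · have := congrFun hw (.inl i)
      simpa [A, Matrix.mulVec, dotProduct, hcast] using this
    · by_contra hj'
      have := congrFun hw (.inr j)
      simp [A, Matrix.mulVec, dotProduct, Matrix.diagonal_apply, hj'] at this
      exact hj this
  obtain ⟨u', v', hu', hv', huv'⟩ := exists_zmod_kernel_pair (p := p) A
    (hker u hu fun j hj => by tauto) (hker v hv fun j hj => by tauto) huv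
  refine ⟨u', v', (hkerp u' hu').1, (hkerp v' hv').1, huv', fun j hj => ?_⟩
  exact hj.elim ((hkerp u' hu').2 j) ((hkerp v' hv').2 j)


/-! ### The union bound -/

/-- The pair `(u, v)` is annihilated by the signs `r`. -/
def SignsKill {N : ℕ} (r : Fin N → Bool) (u v : Fin N → ZMod p) : Prop :=
  ∑ j, boolSign (ZMod p) (r j) * u j = 0 ∧ ∑ j, boolSign (ZMod p) (r j) * v j = 0

theorem prob_exists_signsKill_le {h N : ℕ} (T : Finset (Fin N)) (hT : T.card ≤ h)
    (𝒰 : Set ((Fin N → ZMod p) × (Fin N → ZMod p)))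
    (h𝒰 : ∀ x ∈ 𝒰, ∀ j ∉ T, x.1 j = 0 ∧ x.2 j = 0) {q : ℝ} (hq0 : 0 ≤ q)
    (hq : ∀ x ∈ 𝒰, prob (fun r => SignsKill r x.1 x.2) ≤ q) :
    prob (fun s : Fin h → Fin N → Bool => ∃ x ∈ 𝒰, ∀ i, SignsKill (s i) x.1 x.2) ≤
      (h : ℝ) ^ T.card * q ^ (h - T.card) := by
  let φ : (Fin N → Bool) → T → ZMod p := fun r j => boolSign (ZMod p) (r j)
  let K : (Fin N → ZMod p) → Submodule (ZMod p) (T → ZMod p) := fun u =>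
    LinearMap.ker (Fintype.linearCombination (ZMod p) (fun j : T => u j))
  have hK : ∀ u : Fin N → ZMod p, (∀ j ∉ T, u j = 0) → ∀ r,
      φ r ∈ K u ↔ ∑ j, boolSign (ZMod p) (r j) * u j = 0 := by
    intro u hu r
    have : ∑ j : T, φ r j * u j = ∑ j, boolSign (ZMod p) (r j) * u j := by
      rw [Finset.sum_coe_sort T fun j => boolSign (ZMod p) (r j) * u j]
      exact Finset.sum_subset (Finset.subset_univ T) fun j _ hj => by rw [hu j hj, mul_zero]
    rw [← this]
    simp [K, LinearMap.mem_ker, Fintype.linearCombination_apply]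
  have hK2 : ∀ x ∈ 𝒰, ∀ r, φ r ∈ K x.1 ⊓ K x.2 ↔ SignsKill r x.1 x.2 := by
    intro x hx r
    rw [Submodule.mem_inf, hK _ (fun j hj => (h𝒰 x hx j hj).1),
      hK _ (fun j hj => (h𝒰 x hx j hj).2)]
    rfl
  refine le_trans (prob_mono ?_) (prob_exists_submodule_le (K := ZMod p) φ
    ((fun x => K x.1 ⊓ K x.2) '' 𝒰) hq0 ?_ hT (by simp))
  · rintro s ⟨x, hx, hs⟩
    exact ⟨_, ⟨x, hx, rfl⟩, fun i => (hK2 x hx _).2 (hs i)⟩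
  · rintro _ ⟨x, hx, rfl⟩
    refine le_trans (prob_mono fun r hr => ?_) (hq x hx)
    exact (hK2 x hx r).1 hr

theorem prob_exists_powersetCard_le {α : Type*} [Fintype α] {N : ℕ} (I : Finset ℕ)
    (E : Finset (Fin N) → α → Prop) (b : ℕ → ℝ) (hb : ∀ t ∈ I, 0 ≤ b t)
    (hE : ∀ T : Finset (Fin N), T.card ∈ I → prob (E T) ≤ b T.card) :
    prob (fun a => ∃ T : Finset (Fin N), T.card ∈ I ∧ E T a) ≤ ∑ t ∈ I, (N : ℝ) ^ t * b t := by
  calc _ ≤ prob (fun a => ∃ t ∈ I, ∃ T ∈ Finset.powersetCard t Finset.univ, E T a) := by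
        refine prob_mono ?_
        rintro a ⟨T, hT, ha⟩
        exact ⟨_, hT, T, by simp [Finset.mem_powersetCard], ha⟩
    _ ≤ ∑ t ∈ I, ∑ T ∈ Finset.powersetCard t (Finset.univ : Finset (Fin N)), prob (E T) :=
        (prob_exists_mem_le _ _).trans (Finset.sum_le_sum fun t _ => prob_exists_mem_le _ _)
    _ ≤ ∑ t ∈ I, ∑ _T ∈ Finset.powersetCard t (Finset.univ : Finset (Fin N)), b t := by
        refine Finset.sum_le_sum fun t ht => Finset.sum_le_sum fun T hT => ?_
        obtain rfl := (Finset.mem_powersetCard.1 hT).2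
        exact hE T ht
    _ ≤ _ := by
        refine Finset.sum_le_sum fun t ht => ?_
        rw [Finset.sum_const, Finset.card_powersetCard, Finset.card_univ, Fintype.card_fin,
          nsmul_eq_mul]
        refine mul_le_mul_of_nonneg_right ?_ (hb t ht)
        exact_mod_cast Nat.choose_le_pow N t

theorem prob_exists_vector_le {h N : ℕ} (T : Finset (Fin N)) (hT0 : 0 < T.card) (hT : T.card ≤ h)
    (hp : h < p) (hp2 : p ≠ 2) :
    prob (fun s : Fin h → Fin N → Bool => ∃ u : Fin N → ZMod p, (∀ j, u j ≠ 0 ↔ j ∈ T) ∧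
      ∀ i, ∑ j, boolSign (ZMod p) (s i j) * u j = 0) ≤
      (h : ℝ) ^ T.card * (1 / √T.card) ^ (h - T.card) := by
  refine le_trans (prob_mono ?_) (prob_exists_signsKill_le (p := p) T hT
    {x | (∀ j, x.1 j ≠ 0 ↔ j ∈ T) ∧ x.2 = 0} ?_ (by positivity) ?_)
  · rintro s ⟨u, hu, hs⟩
    exact ⟨(u, 0), ⟨hu, rfl⟩, fun i => ⟨hs i, by simp⟩⟩
  · rintro ⟨u, v⟩ ⟨hu, rfl⟩ j hj
    exact ⟨not_not.1 (mt (hu j).1 hj), rfl⟩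
  · rintro ⟨u, v⟩ ⟨hu, rfl⟩
    refine le_trans (prob_mono fun r hr => ?_)
      (prob_linear_le u T hT0 (hT.trans_lt hp) hp2 fun j hj => (hu j).2 hj)
    exact hr.1

theorem prob_exists_spread_pair_le {h N : ℕ} (T : Finset (Fin N)) (hT0 : 0 < T.card)
    (hT : T.card ≤ h) (hp : h < p) (hp2 : p ≠ 2) :
    prob (fun s : Fin h → Fin N → Bool => ∃ u v : Fin N → ZMod p,
      (∀ j, (u j ≠ 0 ∨ v j ≠ 0) ↔ j ∈ T) ∧
      (∀ x y : ZMod p, x ≠ 0 ∨ y ≠ 0 →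
        2 * (T.filter fun i => x * u i + y * v i = 0).card ≤ T.card) ∧
      ∀ i, SignsKill (s i) u v) ≤
      (h : ℝ) ^ T.card * (4 / T.card) ^ (h - T.card) := by
  refine le_trans (prob_mono ?_) (prob_exists_signsKill_le (p := p) T hT
    {x | (∀ j, (x.1 j ≠ 0 ∨ x.2 j ≠ 0) ↔ j ∈ T) ∧ ∀ a b : ZMod p, a ≠ 0 ∨ b ≠ 0 →
        2 * (T.filter fun i => a * x.1 i + b * x.2 i = 0).card ≤ T.card} ?_ (by positivity) ?_)
  · rintro s ⟨u, v, hu, hspread, hs⟩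
    exact ⟨(u, v), ⟨hu, hspread⟩, hs⟩
  · rintro ⟨u, v⟩ ⟨hu, -⟩ j hj
    have := mt (hu j).1 hj
    tauto
  · rintro ⟨u, v⟩ ⟨hu, hspread⟩
    exact prob_two_linear_le_of_spread u v T hT0 (hT.trans_lt hp) hp2
      (fun j hj => (hu j).2 hj) hspread

theorem prob_exists_small_pair_le {h N : ℕ} {D : ℝ} (hD0 : 0 < D) (hDh : 2 * D ≤ h) :
    prob (fun s : Fin h → Fin N → Bool => ¬ ∀ u v : Fin N → ℝ,
      (signMat s).mulVec u = 0 → (signMat s).mulVec v = 0 → LinearIndependent ℝ ![u, v] →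
      2 * D ≤ ((Function.support u ∪ Function.support v).ncard : ℝ)) ≤
    (∑ t ∈ (Finset.range (h + 1)).filter (fun t : ℕ => 2 ≤ t ∧ (t : ℝ) < D),
      (N : ℝ) ^ t * ((h : ℝ) ^ t * (1 / √t) ^ (h - t))) +
    ∑ t ∈ (Finset.range (h + 1)).filter (fun t : ℕ => D ≤ t ∧ (t : ℝ) < 2 * D),
      (N : ℝ) ^ t * ((h : ℝ) ^ t * (4 / t) ^ (h - t)) := by
  classical
  obtain ⟨p, hhp, hprime⟩ := Nat.exists_infinite_primes (h + 3)
  have : Fact p.Prime := ⟨hprime⟩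
  set I := (Finset.range (h + 1)).filter (fun t : ℕ => 2 ≤ t ∧ (t : ℝ) < D) with hI
  set J := (Finset.range (h + 1)).filter (fun t : ℕ => D ≤ t ∧ (t : ℝ) < 2 * D) with hJ
  have hh : 0 < h := by
    have : (0 : ℝ) < h := by linarith
    exact_mod_cast this
  let E₁ : Finset (Fin N) → (Fin h → Fin N → Bool) → Prop := fun T s =>
    ∃ u : Fin N → ZMod p, (∀ j, u j ≠ 0 ↔ j ∈ T) ∧
      ∀ i, ∑ j, boolSign (ZMod p) (s i j) * u j = 0
  let E₂ : Finset (Fin N) → (Fin h → Fin N → Bool) → Prop := fun T s =>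
    ∃ u v : Fin N → ZMod p, (∀ j, (u j ≠ 0 ∨ v j ≠ 0) ↔ j ∈ T) ∧
      (∀ x y : ZMod p, x ≠ 0 ∨ y ≠ 0 →
        2 * (T.filter fun i => x * u i + y * v i = 0).card ≤ T.card) ∧
      ∀ i, SignsKill (s i) u v
  have hcover : ∀ s : Fin h → Fin N → Bool, (¬ ∀ u v : Fin N → ℝ,
      (signMat s).mulVec u = 0 → (signMat s).mulVec v = 0 → LinearIndependent ℝ ![u, v] →
      2 * D ≤ ((Function.support u ∪ Function.support v).ncard : ℝ)) →
      (∃ T : Finset (Fin N), T.card ∈ I ∧ E₁ T s) ∨ ∃ T : Finset (Fin N), T.card ∈ J ∧ E₂ T s := by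
    intro s hs
    push Not at hs
    obtain ⟨u, v, hu, hv, huv, hlt⟩ := hs
    obtain ⟨u', v', hu', hv', huv', hsupp⟩ := exists_zmod_signs_kernel_pair (p := p) s hu hv huv
    by_cases hsmall : ∃ w : Fin N → ZMod p, w ≠ 0 ∧
        (∀ i, ∑ j, boolSign (ZMod p) (s i j) * w j = 0) ∧
        ((Finset.univ.filter fun j => w j ≠ 0).card : ℝ) < D
    · left
      obtain ⟨w, hw0, hw, hwD⟩ := hsmall
      refine ⟨Finset.univ.filter fun j => w j ≠ 0, ?_, w, by simp, hw⟩
      refine Finset.mem_filter.2 ⟨Finset.mem_range.2 ?_, ?_, hwD⟩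
      · have : ((Finset.univ.filter fun j => w j ≠ 0).card : ℝ) < h + 1 := by linarith
        exact_mod_cast this
      · by_contra! hcard
        obtain ⟨j, hj⟩ := Function.ne_iff.1 hw0
        have hj1 : (Finset.univ.filter fun j => w j ≠ 0).card = 1 := by
          have : 0 < (Finset.univ.filter fun j => w j ≠ 0).card :=
            Finset.card_pos.2 ⟨j, by simpa using hj⟩
          omega
        have hz : ∀ k, k ≠ j → w k = 0 := by
          intro k hk
          by_contra hwk
          exact hk (Finset.card_le_one.1 hj1.le k (by simpa using hwk) j (by simpa using hj))
        have := hw ⟨0, hh⟩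
        rw [Finset.sum_eq_single j (fun k _ hk => by rw [hz k hk, mul_zero])
          (fun h => (h (Finset.mem_univ j)).elim)] at this
        have hsign : boolSign (ZMod p) (s ⟨0, hh⟩ j) ≠ 0 := by
          unfold boolSign; split_ifs <;> simp
        exact (mul_ne_zero hsign hj) this
    · right
      push Not at hsmall
      set T := Finset.univ.filter fun j => u' j ≠ 0 ∨ v' j ≠ 0 with hTdef
      have hT2D : (T.card : ℝ) < 2 * D := by
        refine lt_of_le_of_lt ?_ hlt
        have hsub : (T : Set (Fin N)) ⊆ Function.support u ∪ Function.support v :=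
          fun j hj => hsupp j (by simpa [hTdef] using hj)
        have := Set.ncard_le_ncard hsub (Set.toFinite _)
        rw [Set.ncard_coe_finset] at this
        exact_mod_cast this
      have hkey : ∀ x y : ZMod p, x ≠ 0 ∨ y ≠ 0 →
          D + (T.filter fun i => x * u' i + y * v' i = 0).card ≤ T.card := by
        intro x y hxy
        have h1 := hsmall (x • u' + y • v') (fun h => by
          have := LinearIndependent.pair_iff.1 huv' x y h
          tauto) (fun i => by
            have e : ∑ j, boolSign (ZMod p) (s i j) * (x • u' + y • v') j =
                x * ∑ j, boolSign (ZMod p) (s i j) * u' j +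
                y * ∑ j, boolSign (ZMod p) (s i j) * v' j := by
              rw [Finset.mul_sum, Finset.mul_sum, ← Finset.sum_add_distrib]
              refine Finset.sum_congr rfl fun j _ => ?_
              simp only [Pi.add_apply, Pi.smul_apply, smul_eq_mul]; ring
            rw [e, hu' i, hv' i]; simp)
        have h2 : (Finset.univ.filter fun j => (x • u' + y • v') j ≠ 0) =
            T.filter fun i => ¬ (x * u' i + y * v' i = 0) := by
          ext j
          simp only [Finset.mem_filter, Finset.mem_univ, true_and, Pi.add_apply, Pi.smul_apply,
            smul_eq_mul, hTdef]
          refine ⟨fun hj => ⟨?_, hj⟩, fun hj => hj.2⟩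
          by_contra hcon
          push Not at hcon
          simp [hcon] at hj
        rw [h2] at h1
        have h3 := Finset.card_filter_add_card_filter_not (s := T)
          fun i => x * u' i + y * v' i = 0
        rw [← h3]
        push_cast
        linarith
      refine ⟨T, Finset.mem_filter.2 ⟨Finset.mem_range.2 ?_, ?_, hT2D⟩, u', v',
        by simp [hTdef], fun x y hxy => ?_, fun i => ⟨hu' i, hv' i⟩⟩
      · have : (T.card : ℝ) < h + 1 := by linarith
        exact_mod_cast this
      · have := hkey 1 0 (by simp)
        have h0 : (0 : ℝ) ≤ (T.filter fun i => 1 * u' i + 0 * v' i = 0).card := by positivity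
        linarith
      · have := hkey x y hxy
        have : 2 * ((T.filter fun i => x * u' i + y * v' i = 0).card : ℝ) ≤ T.card := by linarith
        exact_mod_cast this
  refine ((prob_mono hcover).trans (prob_or_le _ _)).trans (add_le_add ?_ ?_)
  · refine prob_exists_powersetCard_le I E₁ _ (fun t _ => by positivity) fun T hT => ?_
    have hT' := Finset.mem_filter.1 hT
    have := Finset.mem_range.1 hT'.1
    exact prob_exists_vector_le T (by omega) (by omega) (by omega) (by omega)
  · refine prob_exists_powersetCard_le J E₂ _ (fun t _ => by positivity) fun T hT => ?_
    have hT' := Finset.mem_filter.1 hT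
    have := Finset.mem_range.1 hT'.1
    have hpos : 0 < T.card := by
      have : (0 : ℝ) < T.card := hD0.trans_le hT'.2.1
      exact_mod_cast this
    exact prob_exists_spread_pair_le T hpos (by omega) (by omega) (by omega)


/-! ### Asymptotics -/

theorem vector_exponent_le {ε d H t Lh : ℝ} (hε : ε ∈ Set.Ioo (0 : ℝ) 1) (hd : 0 < d)
    (hdH : d ≤ ε * H / 16) (hLd : 0 ≤ Real.log d) (hLh : Lh ≤ 2 * Real.log d)
    (htwo : 2 * ((1 + H / (2 * d)) * Real.log d + 3 / 2 * Lh) ≤ H / 5)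
    (hbig : -Real.log (1 - ε) / 2 + 1 / 8 ≤ ε * Real.log d / 4)
    (ht2 : 2 ≤ t) (htD : t ≤ (1 - ε) * d) :
    t * ((1 + H / (2 * d)) * Real.log d + 3 / 2 * Lh) - H / 2 * Real.log t ≤ -H / 8 := by
  obtain ⟨hε0, hε1⟩ := hε
  have hH : 0 ≤ H := by
    by_contra! h
    nlinarith
  set K := (1 + H / (2 * d)) * Real.log d + 3 / 2 * Lh with hK
  have hconv : ConvexOn ℝ (Set.Ioi 0) fun x : ℝ => x * K - H / 2 * Real.log x := by
    have h1 : ConvexOn ℝ (Set.Ioi 0) fun x : ℝ => x * K :=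
      ((LinearMap.mulRight ℝ K).convexOn (convex_Ioi 0))
    have h2 : ConcaveOn ℝ (Set.Ioi 0) fun x : ℝ => H / 2 * Real.log x :=
      strictConcaveOn_log_Ioi.concaveOn.smul (by positivity)
    exact h1.sub h2
  have h1ε : 0 < 1 - ε := by linarith
  refine (hconv.le_max_of_mem_Icc (x := 2) (y := (1 - ε) * d) (by simp)
    (Set.mem_Ioi.2 (by positivity)) ⟨ht2, htD⟩).trans (max_le ?_ ?_)
  · have := Real.log_two_gt_d9
    nlinarith
  · rw [Real.log_mul h1ε.ne' hd.ne']
    have e1 : (1 - ε) * d * K = (1 - ε) * d * Real.log d + (1 - ε) * (H / 2) * Real.log d +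
        3 / 2 * ((1 - ε) * d * Lh) := by
      rw [hK]; field_simp
    have e2 : (1 - ε) * d * Real.log d ≤ d * Real.log d := by
      nlinarith [mul_nonneg hε0.le (mul_nonneg hd.le hLd)]
    have e3 : (1 - ε) * d * Lh ≤ 2 * (d * Real.log d) := by
      have : (1 - ε) * d * Lh ≤ (1 - ε) * d * (2 * Real.log d) := by gcongr
      linarith
    have e4 : d * Real.log d ≤ ε * H / 16 * Real.log d := by gcongr
    have e5 := mul_le_mul_of_nonneg_left hbig hH
    nlinarith

theorem pair_exponent_le {ε d H t Lh : ℝ} (hε : ε ∈ Set.Ioo (0 : ℝ) 1) (hd : 0 < d)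
    (hdH : d ≤ ε * H / 16) (hLd : 0 ≤ Real.log d) (hLh0 : 0 ≤ Lh) (hLh : Lh ≤ 2 * Real.log d)
    (hbig : -Real.log (1 - ε) + Real.log 4 + 1 / 8 ≤ ε * Real.log d / 2)
    (htD : (1 - ε) * d ≤ t) (ht2D : t ≤ 2 * ((1 - ε) * d)) :
    t * ((1 + H / (2 * d)) * Real.log d + Lh) + (H - t) * (Real.log 4 - Real.log t) ≤ -H / 8 := by
  obtain ⟨hε0, hε1⟩ := hε
  have hH : 0 ≤ H := by
    by_contra! h
    nlinarith
  have h1ε : 0 < 1 - ε := by linarith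
  have hD : 0 < (1 - ε) * d := by positivity
  have hDd : (1 - ε) * d ≤ d := by nlinarith
  have hlog : Real.log (1 - ε) + Real.log d ≤ Real.log t := by
    rw [← Real.log_mul h1ε.ne' hd.ne']
    exact Real.log_le_log hD htD
  set A := -Real.log (1 - ε) with hA
  have hA0 : 0 ≤ A := by
    have := Real.log_nonpos h1ε.le (by linarith)
    linarith
  have hl4 : 0 ≤ Real.log 4 := Real.log_nonneg (by norm_num)
  set M := Real.log d - A - Real.log 4 with hM
  have hM0 : 0 ≤ M := by nlinarith
  set K := (1 + H / (2 * d)) * Real.log d + Lh with hK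
  have hK0 : 0 ≤ K := by positivity
  have htH : 2 * d ≤ H := by nlinarith
  have s1 : t * K ≤ 2 * ((1 - ε) * d) * K := by gcongr
  have s2 : (H - t) * (Real.log 4 - Real.log t) ≤ -((H - 2 * d) * M) := by
    have a1 : (H - t) * (Real.log 4 - Real.log t) ≤ (H - t) * (-M) :=
      mul_le_mul_of_nonneg_left (by linarith) (by linarith)
    have a2 : (H - 2 * d) * M ≤ (H - t) * M :=
      mul_le_mul_of_nonneg_right (by linarith) hM0
    linarith
  have e1 : 2 * ((1 - ε) * d) * K = 2 * ((1 - ε) * d * Real.log d) + (1 - ε) * H * Real.log d +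
      2 * ((1 - ε) * d * Lh) := by
    rw [hK]; field_simp
  have e2 : (1 - ε) * d * Real.log d ≤ d * Real.log d := by gcongr
  have e3 : (1 - ε) * d * Lh ≤ 2 * (d * Real.log d) := by
    have : (1 - ε) * d * Lh ≤ d * (2 * Real.log d) := by gcongr
    linarith
  have e4 : d * Real.log d ≤ ε * H / 16 * Real.log d := by gcongr
  have e5 := mul_le_mul_of_nonneg_left hbig hH
  have e6 : (H - 2 * d) * M =
      H * Real.log d - 2 * (d * Real.log d) - (H - 2 * d) * (A + Real.log 4) := by
    rw [hM]; ring
  have e7 : (H - 2 * d) * (A + Real.log 4) ≤ H * (A + Real.log 4) := by gcongr; linarith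
  nlinarith

theorem log_NOf_le {δ : ℝ} {h : ℕ} (hd : 1 ≤ (dOf δ h : ℝ)) :
    0 < (NOf δ h : ℝ) ∧
      Real.log (NOf δ h) ≤ (1 + h / (2 * (dOf δ h : ℝ))) * Real.log (dOf δ h) := by
  have hpow : 1 ≤ (dOf δ h : ℝ) ^ ((1 : ℝ) + (h : ℝ) / (2 * (dOf δ h : ℝ))) :=
    Real.one_le_rpow hd (by positivity)
  have hN : 0 < NOf δ h := Nat.floor_pos.2 hpow
  have hN' : (0 : ℝ) < NOf δ h := mod_cast hN
  refine ⟨hN', ?_⟩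
  rw [← Real.log_rpow (by linarith)]
  exact Real.log_le_log hN' (Nat.floor_le (by positivity))

theorem vector_term_le {ε δ : ℝ} {h t : ℕ} (hε : ε ∈ Set.Ioo (0 : ℝ) 1) (hd : 1 ≤ (dOf δ h : ℝ))
    (hdH : (dOf δ h : ℝ) ≤ ε * h / 16) (hLh : Real.log h ≤ 2 * Real.log (dOf δ h))
    (htwo : 2 * ((1 + h / (2 * (dOf δ h : ℝ))) * Real.log (dOf δ h) + 3 / 2 * Real.log h) ≤ h / 5)
    (hbig : -Real.log (1 - ε) / 2 + 1 / 8 ≤ ε * Real.log (dOf δ h) / 4)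
    (hth : t ≤ h) (ht2 : 2 ≤ t) (htD : (t : ℝ) ≤ (1 - ε) * dOf δ h) :
    (NOf δ h : ℝ) ^ t * ((h : ℝ) ^ t * (1 / √t) ^ (h - t)) ≤ Real.exp (-h / 8) := by
  obtain ⟨hN, hlogN⟩ := log_NOf_le hd
  have ht0 : (0 : ℝ) < t := by positivity
  have hh0 : (0 : ℝ) < h := mod_cast (by omega : 0 < h)
  have hth' : (t : ℝ) ≤ h := mod_cast hth
  rw [← Real.log_le_iff_le_exp (by positivity)]
  refine le_trans ?_ (vector_exponent_le hε (by linarith) hdH (Real.log_nonneg hd) hLh htwo hbig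
    (by exact_mod_cast ht2) htD)
  rw [Real.log_mul (by positivity) (by positivity), Real.log_mul (by positivity) (by positivity),
    Real.log_pow, Real.log_pow, Real.log_pow, one_div, Real.log_inv, Real.log_sqrt ht0.le,
    Nat.cast_sub hth]
  have h1 := mul_le_mul_of_nonneg_left hlogN ht0.le
  have h2 := mul_le_mul_of_nonneg_left (Real.log_le_log ht0 hth') ht0.le
  linarith

theorem pair_term_le {ε δ : ℝ} {h t : ℕ} (hε : ε ∈ Set.Ioo (0 : ℝ) 1) (hd : 1 ≤ (dOf δ h : ℝ))
    (hdH : (dOf δ h : ℝ) ≤ ε * h / 16) (hLh : Real.log h ≤ 2 * Real.log (dOf δ h))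
    (hbig : -Real.log (1 - ε) + Real.log 4 + 1 / 8 ≤ ε * Real.log (dOf δ h) / 2)
    (hth : t ≤ h) (htD : (1 - ε) * dOf δ h ≤ t) (ht2D : (t : ℝ) ≤ 2 * ((1 - ε) * dOf δ h)) :
    (NOf δ h : ℝ) ^ t * ((h : ℝ) ^ t * (4 / t) ^ (h - t)) ≤ Real.exp (-h / 8) := by
  obtain ⟨hN, hlogN⟩ := log_NOf_le hd
  have ht0 : (0 : ℝ) < t := lt_of_lt_of_le (mul_pos (by linarith [hε.2]) (by linarith)) htD
  have hth' : (t : ℝ) ≤ h := mod_cast hth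
  have hh0 : (0 : ℝ) < h := by linarith
  have hh1 : (1 : ℝ) ≤ h := by
    have : 0 < h := mod_cast hh0
    exact_mod_cast this
  rw [← Real.log_le_iff_le_exp (by positivity)]
  refine le_trans ?_ (pair_exponent_le hε (by linarith) hdH (Real.log_nonneg hd)
    (Real.log_nonneg hh1) hLh hbig htD ht2D)
  rw [Real.log_mul (by positivity) (by positivity), Real.log_mul (by positivity) (by positivity),
    Real.log_pow, Real.log_pow, Real.log_pow, Real.log_div (by norm_num) ht0.ne',
    Nat.cast_sub hth]
  have h1 := mul_le_mul_of_nonneg_left hlogN ht0.le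
  linarith

theorem prob_small_pair_le_exp {ε δ : ℝ} {h : ℕ} (hε : ε ∈ Set.Ioo (0 : ℝ) 1)
    (hd : 1 ≤ (dOf δ h : ℝ)) (hdH : (dOf δ h : ℝ) ≤ ε * h / 16)
    (hLh : Real.log h ≤ 2 * Real.log (dOf δ h))
    (htwo : 2 * ((1 + h / (2 * (dOf δ h : ℝ))) * Real.log (dOf δ h) + 3 / 2 * Real.log h) ≤ h / 5)
    (hbig : -Real.log (1 - ε) + Real.log 4 + 1 / 8 ≤ ε * Real.log (dOf δ h) / 4) :
    prob (fun s : Fin h → Fin (NOf δ h) → Bool => ¬ ∀ u v : Fin (NOf δ h) → ℝ,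
      (signMat s).mulVec u = 0 → (signMat s).mulVec v = 0 → LinearIndependent ℝ ![u, v] →
      2 * ((1 - ε) * dOf δ h) ≤ ((Function.support u ∪ Function.support v).ncard : ℝ)) ≤
    2 * ((h + 1) * Real.exp (-h / 8)) := by
  obtain ⟨hε0, hε1⟩ := id hε
  have h1ε : 0 < 1 - ε := by linarith
  have hA : 0 ≤ -Real.log (1 - ε) := by
    have := Real.log_nonpos h1ε.le (by linarith)
    linarith
  have hl4 : 0 ≤ Real.log 4 := Real.log_nonneg (by norm_num)
  have hLd : 0 ≤ ε * Real.log (dOf δ h) := mul_nonneg hε0.le (Real.log_nonneg hd)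
  have hh : (0 : ℝ) ≤ h := by positivity
  have hsum : ∀ (P : ℕ → Prop) [DecidablePred P] (b : ℕ → ℝ),
      (∀ t ≤ h, P t → b t ≤ Real.exp (-h / 8)) →
      ∑ t ∈ (Finset.range (h + 1)).filter P, b t ≤ (h + 1) * Real.exp (-h / 8) := by
    intro P _ b hb
    refine (Finset.sum_le_card_nsmul _ _ (Real.exp (-h / 8)) fun t ht => ?_).trans ?_
    · obtain ⟨ht, hP⟩ := Finset.mem_filter.1 ht
      exact hb t (Nat.lt_succ_iff.1 (Finset.mem_range.1 ht)) hP
    · rw [nsmul_eq_mul]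
      gcongr
      have := Finset.card_filter_le (Finset.range (h + 1)) P
      rw [Finset.card_range] at this
      exact_mod_cast this
  refine (prob_exists_small_pair_le (by positivity) (by nlinarith)).trans ?_
  rw [two_mul ((h + 1) * Real.exp (-h / 8))]
  refine add_le_add (hsum _ _ fun t hth ht => ?_) (hsum _ _ fun t hth ht => ?_)
  · exact vector_term_le hε hd hdH hLh htwo (by linarith) hth ht.1 ht.2.le
  · exact pair_term_le hε hd hdH hLh (by linarith) hth ht.1 ht.2.le

end SignSums

theorem stmt10 : ∃ c₂ : ℝ, 0 < c₂ ∧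
    ∀ ε : ℝ, ε ∈ Set.Ioo (0 : ℝ) 1 → ∀ δ : ℝ, δ ∈ Set.Ioc (0 : ℝ) (c₂ * ε) →
      Filter.Tendsto (fun h : ℕ =>
        prob (fun s : Fin h → Fin (NOf δ h) → Bool =>
          ∀ u v : Fin (NOf δ h) → ℝ,
            (signMat s).mulVec u = 0 → (signMat s).mulVec v = 0 →
            LinearIndependent ℝ ![u, v] →
            2 * (1 - ε) * (dOf δ h : ℝ) ≤
              ((Function.support u ∪ Function.support v).ncard : ℝ)))
        Filter.atTop (nhds 1) := by
  refine ⟨1 / 32, by norm_num, fun ε hε δ hδ => ?_⟩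
  obtain ⟨hδ0, hδε⟩ := hδ
  have hH : Filter.Tendsto (fun h : ℕ => (h : ℝ)) Filter.atTop Filter.atTop :=
    tendsto_natCast_atTop_atTop
  have hdlow : ∀ h : ℕ, δ * h ≤ dOf δ h := fun h => Nat.le_ceil _
  have hdtop : Filter.Tendsto (fun h : ℕ => (dOf δ h : ℝ)) Filter.atTop Filter.atTop :=
    Filter.tendsto_atTop_mono hdlow (hH.const_mul_atTop hδ0)
  have hlogd : Filter.Tendsto (fun h : ℕ => ε * Real.log (dOf δ h)) Filter.atTop Filter.atTop :=
    (Real.tendsto_log_atTop.comp hdtop).const_mul_atTop hε.1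
  have hlogh : ∀ᶠ h : ℕ in Filter.atTop, (5 + 1 / δ) * Real.log h ≤ h / 5 := by
    have := (Real.isLittleO_log_id_atTop.comp_tendsto hH).def
      (c := 1 / (5 * (5 + 1 / δ))) (by positivity)
    filter_upwards [this, hH.eventually_ge_atTop 1] with h h1 h2
    have h3 : Real.log h ≤ 1 / (5 * (5 + 1 / δ)) * h := by
      simpa [abs_of_nonneg (Real.log_nonneg h2)] using h1
    calc (5 + 1 / δ) * Real.log h ≤ (5 + 1 / δ) * (1 / (5 * (5 + 1 / δ)) * h) := by gcongr
      _ = h / 5 := by field_simp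
  have hmain : ∀ᶠ h : ℕ in Filter.atTop,
      1 - 2 * ((h + 1) * Real.exp (-h / 8)) ≤
        prob (fun s : Fin h → Fin (NOf δ h) → Bool =>
          ∀ u v : Fin (NOf δ h) → ℝ,
            (signMat s).mulVec u = 0 → (signMat s).mulVec v = 0 →
            LinearIndependent ℝ ![u, v] →
            2 * (1 - ε) * (dOf δ h : ℝ) ≤
              ((Function.support u ∪ Function.support v).ncard : ℝ)) := by
    filter_upwards [hdtop.eventually_ge_atTop 1, hH.eventually_ge_atTop 1,
      hH.eventually_ge_atTop (1 / δ), hH.eventually_ge_atTop (1 / δ ^ 2), hlogh,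
      hlogd.eventually_ge_atTop (4 * (-Real.log (1 - ε) + Real.log 4 + 1 / 8))]
      with h hd hh1 hhδ hhδ2 hlogh hbig
    have hh0 : (0 : ℝ) < h := by linarith
    have hδh : 1 ≤ δ * h := by rwa [div_le_iff₀' hδ0] at hhδ
    have hdup : (dOf δ h : ℝ) ≤ 2 * (δ * h) := by
      have := (Nat.ceil_lt_add_one (by positivity : 0 ≤ δ * h)).le
      change (dOf δ h : ℝ) ≤ _ at this
      linarith
    have hdH : (dOf δ h : ℝ) ≤ ε * h / 16 := by nlinarith
    have hdh : (dOf δ h : ℝ) ≤ h := by nlinarith [hε.2]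
    have hLh : Real.log h ≤ 2 * Real.log (dOf δ h) := by
      have h1 : (h : ℝ) ≤ (dOf δ h : ℝ) ^ 2 := by
        rw [div_le_iff₀' (by positivity)] at hhδ2
        calc (h : ℝ) ≤ (δ ^ 2 * h) * h := le_mul_of_one_le_left hh0.le hhδ2
          _ = (δ * h) ^ 2 := by ring
          _ ≤ _ := pow_le_pow_left₀ (by positivity) (hdlow h) 2
      have := Real.log_le_log hh0 h1
      rwa [Real.log_pow] at this
    have htwo : 2 * ((1 + h / (2 * (dOf δ h : ℝ))) * Real.log (dOf δ h) + 3 / 2 * Real.log h) ≤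
        h / 5 := by
      have h1 : Real.log (dOf δ h) ≤ Real.log h := Real.log_le_log (by linarith) hdh
      have h2 : h / (2 * (dOf δ h : ℝ)) ≤ 1 / (2 * δ) := by
        rw [div_le_div_iff₀ (by linarith) (by positivity)]
        nlinarith [hdlow h]
      have h3 : (1 + h / (2 * (dOf δ h : ℝ))) * Real.log (dOf δ h) ≤
          (1 + 1 / (2 * δ)) * Real.log h := by
        gcongr
      have h4 : 2 * ((1 + 1 / (2 * δ)) * Real.log h + 3 / 2 * Real.log h) =
          (5 + 1 / δ) * Real.log h := by field_simp; ring
      linarith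
    have key := prob_small_pair_le_exp hε hd hdH hLh htwo (by linarith)
    rw [prob_not] at key
    simp only [← mul_assoc] at key ⊢
    linarith
  have hlim : Filter.Tendsto (fun h : ℕ => 1 - 2 * (((h : ℝ) + 1) * Real.exp (-h / 8)))
      Filter.atTop (nhds 1) := by
    have h8 : Filter.Tendsto (fun h : ℕ => (h : ℝ) / 8) Filter.atTop Filter.atTop :=
      hH.atTop_div_const (by norm_num)
    have e1 := (Real.tendsto_pow_mul_exp_neg_atTop_nhds_zero 1).comp h8
    have e0 := (Real.tendsto_pow_mul_exp_neg_atTop_nhds_zero 0).comp h8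
    have := (((e1.const_mul 8).add e0).const_mul 2).const_sub 1
    simp only [mul_zero, add_zero, sub_zero] at this
    refine this.congr fun h => ?_
    simp only [Function.comp_apply, pow_one, pow_zero, one_mul, neg_div]
    ring
  exact tendsto_of_tendsto_of_tendsto_of_le_of_le' hlim tendsto_const_nhds hmain
    (Filter.Eventually.of_forall fun h => prob_le_one _)
end
end
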